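/- arXiv:2405.18815 — 4 statements merged into one kernel-verified Lean document; each statement's English description precedes it below -/
import Mathlib

section
/- Let G be a finite simple graph, let d_v denote the degree of vertex v in G, and let iso(G) denote the number of isolated vertices of G. Then i(G) ≤ 2^{iso(G)} · ∏_{uv ∈ E(G)} (2^{d_u} + 2^{d_v} − 1)^{1/(d_u d_v)}, where the product is over the edges of G. Moreover, equality holds if and only if G is a disjoint union of complete bipartite graphs and isolated vertices. -/
open Finset
open scoped Classical

/-- The number of independent sets of a finite simple graph `G`
(including the empty set). -/
noncomputable def numIndepSets {V : Type*} [Fintype V] (G : SimpleGraph V) : ℕ :=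
  (Finset.univ.filter fun S : Finset V => ∀ u ∈ S, ∀ v ∈ S, ¬ G.Adj u v).card

/-- The number of isolated vertices (vertices of degree `0`) of `G`. -/
noncomputable def numIsolated {V : Type*} [Fintype V] (G : SimpleGraph V) : ℕ :=
  (Finset.univ.filter fun v : V => G.degree v = 0).card

/-- The weight `(2^{d_u} + 2^{d_v} - 1)^{1/(d_u d_v)} = i(K_{d_u,d_v})^{1/(d_u d_v)}`
attached to the edge `uv`, as a symmetric function on `Sym2 V`. -/
noncomputable def edgeWeight {V : Type*} [Fintype V] (G : SimpleGraph V) : Sym2 V → ℝ :=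
  Sym2.lift ⟨fun u v =>
      ((2:ℝ) ^ G.degree u + (2:ℝ) ^ G.degree v - 1) ^
        ((1:ℝ) / ((G.degree u : ℝ) * (G.degree v : ℝ))),
    fun u v => by
      simp only []
      rw [add_comm ((2:ℝ) ^ G.degree u), mul_comm ((G.degree u : ℝ))]⟩

/-- `G` is a disjoint union of complete bipartite graphs and isolated vertices:
every connected component of `G` (as an induced subgraph) is isomorphic to a complete
bipartite graph `K_{a,b}` (isolated vertices corresponding to `K_{1,0}`). -/
def IsDisjUnionCompleteBipartiteAndIsolated {V : Type*} (G : SimpleGraph V) : Prop :=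
  ∀ C : G.ConnectedComponent,
    ∃ a b : ℕ, Nonempty
      ((G.induce {v | G.connectedComponentMk v = C}) ≃g completeBipartiteGraph (Fin a) (Fin b))

theorem add_lt_add_of_mul_le_mul {x y z w : ℝ} (hx : 0 < x) (hz : z < x) (hw : w < x)
    (h : z * w ≤ x * y) : z + w < x + y := by
  nlinarith [mul_pos (sub_pos.2 hz) (sub_pos.2 hw)]

theorem rpow_add_lt_rpow_add_of_mul_le_mul {x y z w r : ℝ} (hr : 0 < r) (hy : 0 ≤ y) (hz : 0 ≤ z)
    (hw : 0 ≤ w) (hzx : z < x) (hwx : w < x) (h : z * w ≤ x * y) :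
    z ^ r + w ^ r < x ^ r + y ^ r := by
  have hx : 0 < x := hz.trans_lt hzx
  refine add_lt_add_of_mul_le_mul (Real.rpow_pos_of_pos hx r) (Real.rpow_lt_rpow hz hzx hr)
    (Real.rpow_lt_rpow hw hwx hr) ?_
  rw [← Real.mul_rpow hz hw, ← Real.mul_rpow hx.le hy]
  exact Real.rpow_le_rpow (mul_nonneg hz hw) h hr.le

theorem rpow_increment_lt {t ε n U : ℝ} (ht : 1 < t) (hε : 0 < ε) (hε1 : ε < 1) (hn : 0 < n)
    (hU : (1 + n * ε) * (1 + ε) ≤ U * (1 - ε)) :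
    (1 + n * ε) ^ t - 1 + n * ((1 + ε) ^ t + (1 - ε) ^ t - 2) < (U + n * ε) ^ t - U ^ t := by
  have hU1 : 1 + ε < U := by
    have : 0 < n * ε := mul_pos hn hε
    have h1 : 0 < 1 - ε := by linarith
    by_contra! hc
    nlinarith [mul_le_mul_of_nonneg_right hc h1.le, mul_pos this hε]
  let K : ℝ → ℝ := fun s => (U + n * s) ^ t - (1 + n * s) ^ t - n * ((1 + s) ^ t + (1 - s) ^ t)
  have hder : ∀ s, HasDerivAt K
      (n * t * (U + n * s) ^ (t - 1) - n * t * (1 + n * s) ^ (t - 1)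
        - n * (1 * t * (1 + s) ^ (t - 1) + (-1) * t * (1 - s) ^ (t - 1))) s := by
    intro s
    have hlin : ∀ c : ℝ, HasDerivAt (fun s => c + n * s) n s := fun c => by
      simpa using ((hasDerivAt_id s).const_mul n).const_add c
    have e1 := (hlin U).rpow_const (p := t) (Or.inr ht.le)
    have e2 := (hlin 1).rpow_const (p := t) (Or.inr ht.le)
    have e3 := ((hasDerivAt_id s).const_add 1).rpow_const (p := t) (Or.inr ht.le)
    have e4 := ((hasDerivAt_id s).const_sub 1).rpow_const (p := t) (Or.inr ht.le)
    exact (e1.sub e2).sub ((e3.add e4).const_mul n)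
  have hmono : StrictMonoOn K (Set.Icc 0 ε) := by
    refine strictMonoOn_of_deriv_pos (convex_Icc 0 ε)
      (fun s _ => (hder s).continuousAt.continuousWithinAt) fun s hs => ?_
    rw [interior_Icc] at hs
    rw [(hder s).deriv]
    obtain ⟨hs0, hs1⟩ := hs
    have hns : 0 < n * s := mul_pos hn hs0
    have hnε : n * s < n * ε := mul_lt_mul_of_pos_left hs1 hn
    have key := rpow_add_lt_rpow_add_of_mul_le_mul (x := U + n * s) (y := 1 - s) (z := 1 + n * s)
      (w := 1 + s) (r := t - 1) (by linarith) (by linarith) (by linarith) (by linarith)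
      (by linarith) (by linarith) (by nlinarith)
    have : 0 < n * t := mul_pos hn (by linarith)
    nlinarith
  have := hmono (Set.left_mem_Icc.2 hε.le) (Set.right_mem_Icc.2 hε.le) hε
  simp only [K, mul_zero, add_zero, sub_zero, Real.one_rpow] at this
  linarith

theorem geometric_step_lt {t a E : ℝ} (ht : 1 < t) (ha : 1 < a) (hE : 1 < E) :
    (E - 1 + (1 + (a - 1) * (E / 2)) ^ t) * (a ^ t + 1) <
      (2 * E - 1 + (1 + (a - 1) * E) ^ t) * ((a + 1) / 2) ^ t := by
  have hm : 0 < (a + 1) / 2 := by linarith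
  have ha1 : a + 1 ≠ 0 := by linarith
  set m := (a + 1) / 2 with hm'
  set P := 1 + (a - 1) * (E / 2) with hP
  have hP0 : 0 < P := by nlinarith
  set ε := (a - 1) / (a + 1) with hε
  have hε0 : 0 < ε := div_pos (by linarith) (by linarith)
  have hε1 : ε < 1 := (div_lt_one (by linarith)).2 (by linarith)
  have hεP : 1 + (E - 1) * ε = P * (1 - ε) := by rw [hε, hP]; field_simp; ring
  have key := rpow_increment_lt (U := P * (1 + ε)) (n := E - 1) ht hε0 hε1 (by linarith)
    (by rw [hεP]; linarith)
  have hmt : 0 < m ^ t := Real.rpow_pos_of_pos hm t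
  have key2 := mul_lt_mul_of_pos_right key hmt
  have f1 : (1 + (E - 1) * ε) ^ t * m ^ t = P ^ t := by
    rw [← Real.mul_rpow (by nlinarith) hm.le]; congr 1
    rw [hm', hP, hε]; field_simp; ring
  have f2 : (1 + ε) ^ t * m ^ t = a ^ t := by
    rw [← Real.mul_rpow (by linarith) hm.le]; congr 1
    rw [hm', hε]; field_simp; ring
  have f3 : (1 - ε) ^ t * m ^ t = 1 := by
    have h1 : (1 - ε) * m = 1 := by rw [hm', hε]; field_simp; ring
    rw [← Real.mul_rpow (by linarith) hm.le, h1, Real.one_rpow]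
  have f4 : (P * (1 + ε)) ^ t * m ^ t = P ^ t * a ^ t := by
    rw [Real.mul_rpow hP0.le (by linarith), mul_assoc, f2]
  have f5 : P * (1 + ε) + (E - 1) * ε = 1 + (a - 1) * E := by
    rw [hP, hε]; field_simp; ring
  rw [f5] at key2
  nlinarith

theorem geometric_ineq {t a : ℝ} (ht : 1 < t) (ha : 1 < a) (d : ℕ) :
    (a ^ t + 1) ^ (d + 1) ≤
      (2 ^ (d + 1) - 1 + (1 + (a - 1) * 2 ^ d) ^ t) * (((a + 1) / 2) ^ t) ^ d ∧
    (0 < d → (a ^ t + 1) ^ (d + 1) <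
      (2 ^ (d + 1) - 1 + (1 + (a - 1) * 2 ^ d) ^ t) * (((a + 1) / 2) ^ t) ^ d) := by
  induction d with
  | zero => simp; norm_num; linarith
  | succ d ih =>
    suffices h : (a ^ t + 1) ^ (d + 1 + 1) <
        (2 ^ (d + 1 + 1) - 1 + (1 + (a - 1) * 2 ^ (d + 1)) ^ t) * (((a + 1) / 2) ^ t) ^ (d + 1) from
      ⟨h.le, fun _ => h⟩
    have hE : (1 : ℝ) < 2 ^ (d + 1) := one_lt_pow₀ (by norm_num) (by simp)
    have step := geometric_step_lt ht ha hE
    have hhalf : (2 : ℝ) ^ (d + 1) / 2 = 2 ^ d := by rw [pow_succ]; ring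
    rw [hhalf] at step
    have hat : 0 < a ^ t + 1 := by have := Real.rpow_pos_of_pos (zero_lt_one.trans ha) t; linarith
    have hmd : 0 < (((a + 1) / 2) ^ t) ^ d := pow_pos (Real.rpow_pos_of_pos (by linarith) t) d
    calc (a ^ t + 1) ^ (d + 1 + 1) = (a ^ t + 1) ^ (d + 1) * (a ^ t + 1) := pow_succ _ _
      _ ≤ _ := mul_le_mul_of_nonneg_right ih.1 hat.le
      _ = ((2 ^ (d + 1) - 1 + (1 + (a - 1) * 2 ^ d) ^ t) * (a ^ t + 1)) *
          (((a + 1) / 2) ^ t) ^ d := by ring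
      _ < _ := mul_lt_mul_of_pos_right step hmd
      _ = _ := by rw [pow_succ _ (d + 1), pow_succ _ d]; ring

/-- The logarithm of `i(K_{a,b}) ^ (1 / (a * b))`. -/
noncomputable def logEdgeWeight (a b : ℕ) : ℝ :=
  Real.log (2 ^ a + 2 ^ b - 1) / (a * b)

theorem one_lt_two_pow_add_two_pow_sub_one {a b : ℕ} (h : 0 < a ∨ 0 < b) :
    (1 : ℝ) < 2 ^ a + 2 ^ b - 1 := by
  have ha : (1 : ℝ) ≤ 2 ^ a := one_le_pow₀ (by norm_num)
  have hb : (1 : ℝ) ≤ 2 ^ b := one_le_pow₀ (by norm_num)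
  rcases h with h | h
  · have : (1 : ℝ) < 2 ^ a := one_lt_pow₀ (by norm_num) h.ne'
    linarith
  · have : (1 : ℝ) < 2 ^ b := one_lt_pow₀ (by norm_num) h.ne'
    linarith

theorem exp_logEdgeWeight {a b : ℕ} (h : 0 < a) :
    Real.exp (logEdgeWeight a b) = ((2 : ℝ) ^ a + 2 ^ b - 1) ^ ((1 : ℝ) / (a * b)) := by
  rw [Real.rpow_def_of_pos (by linarith [one_lt_two_pow_add_two_pow_sub_one (b := b) (.inl h)]),
    logEdgeWeight, mul_one_div]

theorem mul_logEdgeWeight_sub_lt {m c b : ℕ} (hm : 0 < m) (hmc : m < c) (hb : 0 < b) :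
    m * (logEdgeWeight m b - logEdgeWeight c b) < ((c - m : ℕ) : ℝ) / c * Real.log 2 := by
  have hmR : (0 : ℝ) < m := by exact_mod_cast hm
  have hcR : (0 : ℝ) < c := by exact_mod_cast hm.trans hmc
  have hbR : (0 : ℝ) < b := by exact_mod_cast hb
  have hmcR : (m : ℝ) < c := by exact_mod_cast hmc
  set K : ℝ := 2 ^ b - 1 with hK
  have hK0 : 0 < K := by
    have : (1 : ℝ) < 2 ^ b := one_lt_pow₀ (by norm_num) hb.ne'
    linarith
  have hc1 : (1 : ℝ) < 2 ^ c := one_lt_pow₀ (by norm_num) (by lia)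
  have hm1 : (0 : ℝ) < 2 ^ m := by positivity
  have hN : 0 < 2 ^ c + K := by linarith
  set l : ℝ := m / c with hl
  have hl0 : 0 < l := div_pos hmR hcR
  have hl1 : l < 1 := (div_lt_one hcR).2 hmcR
  have hne : Real.log (2 ^ c / (2 ^ c + K)) ≠ Real.log (1 / (1 + K)) := by
    intro h
    have := Real.log_injOn_pos (Set.mem_Ioi.2 (by positivity)) (Set.mem_Ioi.2 (by positivity)) h
    rw [div_eq_div_iff (by positivity) (by positivity)] at this
    nlinarith
  have h1 := strictConvexOn_exp.2 (Set.mem_univ _) (Set.mem_univ _) hne hl0 (sub_pos.2 hl1)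
    (by ring)
  have h2 := convexOn_exp.2 (Set.mem_univ (Real.log (K / (2 ^ c + K))))
    (Set.mem_univ (Real.log (K / (1 + K)))) hl0.le (sub_pos.2 hl1).le (by ring)
  simp only [smul_eq_mul] at h1 h2
  rw [Real.exp_log (by positivity), Real.exp_log (by positivity)] at h1 h2
  have hsum : l * (2 ^ c / (2 ^ c + K)) + (1 - l) * (1 / (1 + K)) +
      (l * (K / (2 ^ c + K)) + (1 - l) * (K / (1 + K))) = 1 := by field_simp; ring
  have hlt := (add_lt_add_of_lt_of_le h1 h2).trans_eq hsum
  set M : ℝ := l * Real.log (2 ^ c + K) + (1 - l) * Real.log (1 + K) with hM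
  rw [Real.log_div (by positivity) (by positivity), Real.log_div (by positivity) (by positivity),
    Real.log_div (by positivity) (by positivity), Real.log_div (by positivity) (by positivity),
    Real.log_pow, Real.log_one] at hlt
  have e1 : l * (c * Real.log 2 - Real.log (2 ^ c + K)) + (1 - l) * (0 - Real.log (1 + K)) =
      m * Real.log 2 - M := by
    rw [hM, hl]; field_simp; ring
  have e2 : l * (Real.log K - Real.log (2 ^ c + K)) + (1 - l) * (Real.log K - Real.log (1 + K)) =
      Real.log K - M := by rw [hM]; ring
  rw [e1, e2, Real.exp_sub, Real.exp_sub, Real.exp_log hK0, ← Real.log_pow, Real.exp_log hm1,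
    ← add_div, div_lt_one (Real.exp_pos _)] at hlt
  have h3 : Real.log (2 ^ m + K) < M := (Real.log_lt_iff_lt_exp (by positivity)).2 hlt
  have e3 : (1 : ℝ) + K = 2 ^ b := by rw [hK]; ring
  rw [hM, e3, Real.log_pow] at h3
  have e4 : m * (logEdgeWeight m b - logEdgeWeight c b) =
      (Real.log (2 ^ m + K) - l * Real.log (2 ^ c + K)) / b := by
    rw [logEdgeWeight, logEdgeWeight, hl, hK, ← add_sub_assoc, ← add_sub_assoc]
    field_simp
  have e5 : ((c - m : ℕ) : ℝ) / c = 1 - l := by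
    rw [Nat.cast_sub hmc.le, hl]; field_simp
  rw [e4, e5, div_lt_iff₀ hbR]
  linarith

theorem exp_add_exp_logEdgeWeight {d y D : ℕ} (hd : 0 < d) (hy : 0 < y) :
    (y < D → Real.exp (d * (D * (logEdgeWeight y d - logEdgeWeight y (d + 1))) -
        D * logEdgeWeight D (d + 1)) +
      Real.exp (d * (D * (Real.log 2 / y - logEdgeWeight y (d + 1))) -
        D * logEdgeWeight D (d + 1)) < 1) ∧
    (y = D → Real.exp (d * (D * (logEdgeWeight y d - logEdgeWeight y (d + 1))) -
        D * logEdgeWeight D (d + 1)) +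
      Real.exp (d * (D * (Real.log 2 / y - logEdgeWeight y (d + 1))) -
        D * logEdgeWeight D (d + 1)) = 1) := by
  have hdR : (0 : ℝ) < d := by exact_mod_cast hd
  have hyR : (0 : ℝ) < y := by exact_mod_cast hy
  have hA := zero_lt_one.trans (one_lt_two_pow_add_two_pow_sub_one (b := d) (.inl hy))
  have hN := zero_lt_one.trans (one_lt_two_pow_add_two_pow_sub_one (b := d + 1) (.inl hy))
  have hZ := zero_lt_one.trans
    (one_lt_two_pow_add_two_pow_sub_one (a := D) (b := d + 1) (.inr (by simp)))
  set A : ℝ := 2 ^ y + 2 ^ d - 1 with hA'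
  set N : ℝ := 2 ^ y + 2 ^ (d + 1) - 1 with hN'
  set Z : ℝ := 2 ^ D + 2 ^ (d + 1) - 1 with hZ'
  set B : ℝ := 2 ^ d with hB'
  have hB : 0 < B := by positivity
  have hAB : A + B = N := by rw [hA', hN', hB']; ring
  set t : ℝ := D / y with ht
  constructor
  · intro hyD
    have hDR : (0 : ℝ) < D := by exact_mod_cast hy.trans hyD
    have ht1 : 1 < t := (one_lt_div hyR).2 (by exact_mod_cast hyD)
    set L : ℝ := d * t / (d + 1) * Real.log N + Real.log Z / (d + 1) with hL
    have e1 : d * (D * (logEdgeWeight y d - logEdgeWeight y (d + 1))) -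
        D * logEdgeWeight D (d + 1) = Real.log A * t - L := by
      rw [logEdgeWeight, logEdgeWeight, logEdgeWeight, hL, ht]
      push_cast
      field_simp
      ring
    have e2 : d * (D * (Real.log 2 / y - logEdgeWeight y (d + 1))) -
        D * logEdgeWeight D (d + 1) = Real.log B * t - L := by
      rw [logEdgeWeight, logEdgeWeight, hL, ht, hB', Real.log_pow]
      push_cast
      field_simp
      ring
    rw [e1, e2, Real.exp_sub, Real.exp_sub, ← Real.rpow_def_of_pos hA, ← Real.rpow_def_of_pos hB,
      ← add_div, div_lt_one (Real.exp_pos _)]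
    refine lt_of_pow_lt_pow_left₀ (d + 1) (Real.exp_pos _).le ?_
    have eL : Real.exp L ^ (d + 1) = Z * (N ^ t) ^ d := by
      rw [← Real.exp_nat_mul, hL, Real.rpow_def_of_pos hN, ← Real.exp_nat_mul]
      conv_rhs => rw [← Real.exp_log hZ, ← Real.exp_add]
      congr 1
      push_cast
      field_simp
      ring
    have hX : (1 : ℝ) < 2 ^ y := one_lt_pow₀ (by norm_num) hy.ne'
    have ha : 1 < A / B := (one_lt_div hB).2 (by rw [hA']; linarith)
    have key := (geometric_ineq ht1 ha d).2 hd
    have k1 : (1 + (A / B - 1) * 2 ^ d) ^ t = 2 ^ D := by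
      have : 1 + (A / B - 1) * 2 ^ d = (2 : ℝ) ^ (y : ℝ) := by
        rw [← hB', Real.rpow_natCast, hA']; field_simp; ring
      rw [this, ← Real.rpow_mul (by norm_num), ht, mul_div_cancel₀ _ hyR.ne', Real.rpow_natCast]
    have k2 : (A / B + 1) / 2 * (2 * B) = N := by rw [← hAB]; field_simp
    have k3 : ((A / B + 1) / 2) ^ t * (2 * B) ^ t = N ^ t := by
      rw [← Real.mul_rpow (by positivity) (by positivity), k2]
    have k4 : ((A / B) ^ t + 1) * B ^ t = A ^ t + B ^ t := by
      rw [add_mul, ← Real.mul_rpow (by positivity) (by positivity), div_mul_cancel₀ _ hB.ne', one_mul]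
    have k5 : ((2 * B) ^ t) ^ d = (B ^ t) ^ (d + 1) := by
      have h2B : 2 * B = 2 ^ (d + 1) := by rw [hB']; ring
      rw [h2B, hB', ← Real.rpow_pow_comm (by norm_num), ← Real.rpow_pow_comm (by norm_num),
        ← pow_mul, ← pow_mul, mul_comm]
    have hBt : 0 < (B ^ t) ^ (d + 1) := by positivity
    rw [← k4, eL, mul_pow, ← k3, mul_pow, k5, ← mul_assoc]
    refine mul_lt_mul_of_pos_right ?_ hBt
    rw [k1] at key
    refine key.trans_eq ?_
    rw [hZ']; ring
  · rintro rfl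
    have e1 : d * (y * (logEdgeWeight y d - logEdgeWeight y (d + 1))) -
        y * logEdgeWeight y (d + 1) = Real.log A - Real.log N := by
      rw [logEdgeWeight, logEdgeWeight]
      push_cast
      field_simp
      ring
    have e2 : d * (y * (Real.log 2 / y - logEdgeWeight y (d + 1))) -
        y * logEdgeWeight y (d + 1) = Real.log B - Real.log N := by
      rw [logEdgeWeight, hB', Real.log_pow]
      push_cast
      field_simp
      ring
    rw [e1, e2, ← Real.log_div hA.ne' hN.ne', ← Real.log_div hB.ne' hN.ne',
      Real.exp_log (by positivity), Real.exp_log (by positivity), ← add_div, hAB, div_self hN.ne']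

theorem exp_sum_le_sum_exp_div {ι : Type*} {s : Finset ι} (hs : s.Nonempty) (x : ι → ℝ) :
    Real.exp (∑ i ∈ s, x i) ≤ (∑ i ∈ s, Real.exp (#s * x i)) / #s := by
  have hc : (0 : ℝ) < #s := by exact_mod_cast hs.card_pos
  have := convexOn_exp.map_sum_le (t := s) (w := fun _ => (1 : ℝ) / #s) (p := fun i => #s * x i)
    (fun _ _ => by positivity) (by simp [hc.ne']) (fun _ _ => Set.mem_univ _)
  simp only [smul_eq_mul] at this
  rw [← mul_sum, ← mul_sum, ← mul_sum, ← mul_assoc, one_div, inv_mul_cancel₀ hc.ne', one_mul]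
    at this
  rwa [div_eq_inv_mul]

theorem exp_sum_add_exp_sum_le_one {ι : Type*} {s : Finset ι} (hs : s.Nonempty) {x y : ι → ℝ}
    (h : ∀ i ∈ s, Real.exp (#s * x i) + Real.exp (#s * y i) ≤ 1) :
    Real.exp (∑ i ∈ s, x i) + Real.exp (∑ i ∈ s, y i) ≤ 1 ∧
    ((∃ i ∈ s, Real.exp (#s * x i) + Real.exp (#s * y i) < 1) →
      Real.exp (∑ i ∈ s, x i) + Real.exp (∑ i ∈ s, y i) < 1) := by
  have hc : (0 : ℝ) < #s := by exact_mod_cast hs.card_pos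
  have key := add_le_add (exp_sum_le_sum_exp_div hs x) (exp_sum_le_sum_exp_div hs y)
  rw [← add_div, ← sum_add_distrib] at key
  have hone : ∑ _i ∈ s, (1 : ℝ) = #s := by simp
  refine ⟨key.trans ((div_le_one hc).2 ((sum_le_sum h).trans_eq hone)), fun hlt => ?_⟩
  exact key.trans_lt ((div_lt_one hc).2 ((sum_lt_sum h hlt).trans_eq hone))

theorem sum_logEdgeWeight_sub_le {β : Type*} (R : Finset β) (e : β → ℕ) (he : ∀ b ∈ R, 0 < e b)
    {c : ℕ} (hc : #R ≤ c) :
    let defect : ℝ := (if #R = 0 then Real.log 2 else 0) - (if c = 0 then Real.log 2 else 0) +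
      ∑ b ∈ R, (logEdgeWeight #R (e b) - logEdgeWeight c (e b))
    defect ≤ (c - #R : ℕ) * (Real.log 2 / c) ∧
      (0 < #R → #R < c → defect < (c - #R : ℕ) * (Real.log 2 / c)) ∧
      (#R = 0 ∨ #R = c → defect = (c - #R : ℕ) * (Real.log 2 / c)) := by
  intro defect
  have heq : #R = 0 ∨ #R = c → defect = (c - #R : ℕ) * (Real.log 2 / c) := by
    rintro (h | h)
    · obtain rfl := card_eq_zero.1 h
      rcases Nat.eq_zero_or_pos c with rfl | hc0
      · simp [defect]
      · have : (c : ℝ) ≠ 0 := by exact_mod_cast hc0.ne'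
        simp [defect, hc0.ne', mul_div_cancel₀ _ this]
    · simp [defect, h]
  have hlt : 0 < #R → #R < c → defect < (c - #R : ℕ) * (Real.log 2 / c) := by
    intro h0 h1
    have hR : (0 : ℝ) < #R := by exact_mod_cast h0
    have hsum := sum_lt_sum_of_nonempty (card_pos.1 h0)
      (fun b hb => (le_div_iff₀' hR).2 (mul_logEdgeWeight_sub_lt h0 h1 (he b hb)).le |>.lt_of_ne
        fun h => (mul_logEdgeWeight_sub_lt h0 h1 (he b hb)).ne (by rw [h]; field_simp))
    simp only [defect, h0.ne', (h0.trans h1).ne', if_false, sub_zero, zero_add]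
    refine hsum.trans_eq ?_
    rw [sum_const, nsmul_eq_mul]
    field_simp
  refine ⟨?_, hlt, heq⟩
  by_cases h : #R = 0 ∨ #R = c
  · exact (heq h).le
  · push Not at h
    exact (hlt (Nat.pos_of_ne_zero h.1) (lt_of_le_of_ne hc h.2)).le

theorem exp_add_exp_sum_logEdgeWeight {α : Type*} (M : Finset α) (y : α → ℕ) {D : ℕ} (hD : 0 < D)
    (hy : ∀ a ∈ M, 0 < y a) (hyD : ∀ a ∈ M, y a ≤ D) :
    let old : ℝ := logEdgeWeight D (#M + 1) + ∑ a ∈ M, logEdgeWeight (y a) (#M + 1)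
    let total : ℝ :=
      Real.exp (D * ((if #M = 0 then Real.log 2 else ∑ a ∈ M, logEdgeWeight (y a) #M) - old)) +
      Real.exp (D * (∑ a ∈ M, Real.log 2 / y a - old))
    total ≤ 1 ∧ ((∃ a ∈ M, y a < D) → total < 1) ∧ ((∀ a ∈ M, y a = D) → total = 1) := by
  intro old total
  have hDR : (0 : ℝ) < D := by exact_mod_cast hD
  rcases Nat.eq_zero_or_pos #M with h0 | h0
  · obtain rfl := card_eq_zero.1 h0
    have hpos : (0 : ℝ) < 2 ^ D + 1 := by positivity
    have e1 : total = 1 := by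
      have h1 : (D : ℝ) * (Real.log 2 - logEdgeWeight D 1) =
          Real.log (2 ^ D) - Real.log (2 ^ D + 1) := by
        rw [logEdgeWeight, Real.log_pow]; push_cast; field_simp; norm_num; ring_nf
      have h2 : (D : ℝ) * (0 - logEdgeWeight D 1) = - Real.log (2 ^ D + 1) := by
        rw [logEdgeWeight]; push_cast; field_simp; norm_num; ring_nf
      simp only [total, old, card_empty, sum_empty, add_zero, zero_add, if_true]
      rw [h1, h2, Real.exp_sub, Real.exp_neg, Real.exp_log hpos, Real.exp_log (by positivity)]
      field_simp
    exact ⟨e1.le, by simp, fun _ => e1⟩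
  · have hMR : (0 : ℝ) < #M := by exact_mod_cast h0
    let x₁ : α → ℝ := fun a => D * (logEdgeWeight (y a) #M - logEdgeWeight (y a) (#M + 1)) -
        D * logEdgeWeight D (#M + 1) / #M
    let x₂ : α → ℝ := fun a => D * (Real.log 2 / y a - logEdgeWeight (y a) (#M + 1)) -
        D * logEdgeWeight D (#M + 1) / #M
    have s1 : D * ((if #M = 0 then Real.log 2 else ∑ a ∈ M, logEdgeWeight (y a) #M) - old) =
        ∑ a ∈ M, x₁ a := by
      simp only [x₁, sum_sub_distrib, ← mul_sum, sum_const, nsmul_eq_mul, h0.ne', if_false, old]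
      field_simp
      ring
    have s2 : D * (∑ a ∈ M, Real.log 2 / y a - old) = ∑ a ∈ M, x₂ a := by
      simp only [x₂, sum_sub_distrib, ← mul_sum, sum_const, nsmul_eq_mul, old]
      field_simp
      ring
    have m1 : ∀ a, #M * x₁ a = #M * (D * (logEdgeWeight (y a) #M - logEdgeWeight (y a) (#M + 1))) -
        D * logEdgeWeight D (#M + 1) := fun a => by
      simp only [x₁]; field_simp
    have m2 : ∀ a, #M * x₂ a = #M * (D * (Real.log 2 / y a - logEdgeWeight (y a) (#M + 1))) -
        D * logEdgeWeight D (#M + 1) := fun a => by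
      simp only [x₂, mul_sub (#M : ℝ)]; rw [mul_div_cancel₀ _ hMR.ne']
    have hlt : ∀ a ∈ M, y a < D → Real.exp (#M * x₁ a) + Real.exp (#M * x₂ a) < 1 := by
      intro a ha h
      rw [m1, m2]
      exact (exp_add_exp_logEdgeWeight h0 (hy a ha)).1 h
    have heq : ∀ a ∈ M, y a = D → Real.exp (#M * x₁ a) + Real.exp (#M * x₂ a) = 1 := by
      intro a ha h
      rw [m1, m2]
      exact (exp_add_exp_logEdgeWeight h0 (hy a ha)).2 h
    have hle : ∀ a ∈ M, Real.exp (#M * x₁ a) + Real.exp (#M * x₂ a) ≤ 1 := fun a ha =>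
      (hyD a ha).lt_or_eq.elim (fun h => (hlt a ha h).le) (fun h => (heq a ha h).le)
    have key := exp_sum_add_exp_sum_le_one (card_pos.1 h0) hle
    simp only [total, s1, s2]
    refine ⟨key.1, fun ⟨a, ha, h⟩ => key.2 ⟨a, ha, hlt a ha h⟩, fun h => ?_⟩
    obtain ⟨a, ha⟩ := card_pos.1 h0
    have c1 : ∑ i ∈ M, x₁ i = #M * x₁ a := by
      rw [sum_congr rfl (g := fun _ => x₁ a) fun i hi => by simp only [x₁, h i hi, h a ha]]
      simp
    have c2 : ∑ i ∈ M, x₂ i = #M * x₂ a := by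
      rw [sum_congr rfl (g := fun _ => x₂ a) fun i hi => by simp only [x₂, h i hi, h a ha]]
      simp
    rw [c1, c2, heq a ha (h a ha)]

section Bipartite

variable {α β : Type*}

/-- The number of elements of `T` related to `a`. -/
noncomputable def degreeIn (r : α → β → Prop) (T : Finset β) (a : α) : ℕ := #{b ∈ T | r a b}

/-- The number of independent sets of the bipartite graph with sides `S` and `T` and edges
given by `r`, counted by their intersection with `S`. -/
noncomputable def numCrossIndep (r : α → β → Prop) (S : Finset α) (T : Finset β) : ℕ :=
  ∑ P ∈ S.powerset, 2 ^ #{b ∈ T | ∀ a ∈ P, ¬ r a b}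

/-- The contribution of the vertex `b` to `logCrossBound`. -/
noncomputable def columnWeight (r : α → β → Prop) (S : Finset α) (T : Finset β) (b : β) : ℝ :=
  if degreeIn (flip r) S b = 0 then Real.log 2
  else ∑ a ∈ S with r a b, logEdgeWeight (degreeIn r T a) (degreeIn (flip r) S b)

/-- The logarithm of the upper bound for `numCrossIndep` in terms of the degrees. -/
noncomputable def logCrossBound (r : α → β → Prop) (S : Finset α) (T : Finset β) : ℝ :=
  ∑ a ∈ S, (if degreeIn r T a = 0 then Real.log 2 else 0) + ∑ b ∈ T, columnWeight r S T b

/-- Every path with three edges in the bipartite graph closes up to a four-cycle. -/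
def CrossClosed (r : α → β → Prop) (S : Finset α) (T : Finset β) : Prop :=
  ∀ a ∈ S, ∀ a' ∈ S, ∀ b ∈ T, ∀ b' ∈ T, r a b → r a' b → r a' b' → r a b'

variable {r : α → β → Prop} {S : Finset α} {T : Finset β} {w : α}

theorem CrossClosed.mono {S' : Finset α} {T' : Finset β} (h : CrossClosed r S T) (hS : S' ⊆ S)
    (hT : T' ⊆ T) : CrossClosed r S' T' :=
  fun a ha a' ha' b hb b' hb' => h a (hS ha) a' (hS ha') b (hT hb) b' (hT hb')

theorem numCrossIndep_erase (hw : w ∈ S) :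
    numCrossIndep r S T =
      numCrossIndep r (S.erase w) T + numCrossIndep r (S.erase w) {b ∈ T | ¬ r w b} := by
  conv_lhs => rw [numCrossIndep, ← insert_erase hw, sum_powerset_insert (notMem_erase w S)]
  rw [numCrossIndep, numCrossIndep]
  congr 1
  refine sum_congr rfl fun P _ => ?_
  rw [filter_filter]
  congr 2
  ext b
  simp

theorem degreeIn_filter_add (a : α) :
    degreeIn r {b ∈ T | ¬ r w b} a + #{b ∈ T | r w b ∧ r a b} = degreeIn r T a := by
  rw [degreeIn, degreeIn, filter_filter,
    ← card_filter_add_card_filter_not (s := {b ∈ T | r a b}) (r w), filter_filter, filter_filter,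
    add_comm]
  simp only [and_comm]

theorem degreeIn_erase_of_not (b : β) (hwb : ¬ r w b) :
    degreeIn (flip r) (S.erase w) b = degreeIn (flip r) S b := by
  have hmem : w ∉ ({a ∈ S | flip r b a} : Finset α) := fun h => hwb (mem_filter.1 h).2
  rw [degreeIn, degreeIn, filter_erase, erase_eq_of_notMem hmem]

theorem degreeIn_erase_add_one (hw : w ∈ S) {b : β} (hwb : r w b) :
    degreeIn (flip r) S b = #{a ∈ S.erase w | r a b} + 1 := by
  rw [degreeIn, filter_erase, card_erase_add_one (by simp [hw, hwb])]
  rfl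

theorem logCrossBound_erase (hdeg : 0 < degreeIn r T w) :
    logCrossBound r (S.erase w) T = logCrossBound r S T +
      ∑ b ∈ T with r w b, (columnWeight r (S.erase w) T b - columnWeight r S T b) := by
  rw [logCrossBound, logCrossBound, sum_erase _ (by simp [hdeg.ne']), add_assoc]
  congr 1
  rw [← sub_eq_iff_eq_add', ← sum_sub_distrib, sum_filter]
  refine sum_congr rfl fun b _ => ?_
  split_ifs with hwb
  · rfl
  · rw [columnWeight, columnWeight, degreeIn_erase_of_not b hwb, filter_erase,
      erase_eq_of_notMem (by simp [hwb]), sub_self]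

theorem logCrossBound_erase_filter (hdeg : 0 < degreeIn r T w) :
    let T' : Finset β := {b ∈ T | ¬ r w b}
    let bound : ℝ := logCrossBound r S T + ∑ b ∈ T with r w b,
      (∑ a ∈ S.erase w with r a b, Real.log 2 / degreeIn r T a - columnWeight r S T b)
    logCrossBound r (S.erase w) T' ≤ bound ∧
      ((∃ a ∈ S.erase w, 0 < degreeIn r T' a ∧ degreeIn r T' a < degreeIn r T a) →
        logCrossBound r (S.erase w) T' < bound) ∧
      ((∀ a ∈ S.erase w, degreeIn r T' a = 0 ∨ degreeIn r T' a = degreeIn r T a) →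
        logCrossBound r (S.erase w) T' = bound) := by
  intro T' bound
  let defect : α → ℝ := fun a =>
    (if degreeIn r T' a = 0 then Real.log 2 else 0) -
      (if degreeIn r T a = 0 then Real.log 2 else 0) +
      ∑ b ∈ T' with r a b, (logEdgeWeight (degreeIn r T' a) (degreeIn (flip r) S b) -
        logEdgeWeight (degreeIn r T a) (degreeIn (flip r) S b))
  let gain : α → ℝ := fun a =>
    (degreeIn r T a - degreeIn r T' a : ℕ) * (Real.log 2 / degreeIn r T a)
  have hcol : ∀ b ∈ T', columnWeight r (S.erase w) T' b - columnWeight r S T b =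
      ∑ a ∈ S.erase w with r a b, (logEdgeWeight (degreeIn r T' a) (degreeIn (flip r) S b) -
        logEdgeWeight (degreeIn r T a) (degreeIn (flip r) S b)) := by
    intro b hb
    have hwb : ¬ r w b := (mem_filter.1 hb).2
    rw [columnWeight, columnWeight, degreeIn_erase_of_not b hwb, filter_erase,
      erase_eq_of_notMem (by simp [hwb])]
    split_ifs with h0
    · rw [degreeIn, card_eq_zero] at h0
      have : ({a ∈ S | r a b} : Finset α) = ∅ := h0
      simp [this]
    · rw [sum_sub_distrib]
  have hdefect : logCrossBound r (S.erase w) T' =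
      logCrossBound r S T - ∑ b ∈ T with r w b, columnWeight r S T b +
        ∑ a ∈ S.erase w, defect a := by
    have e1 : ∑ b ∈ T, columnWeight r S T b = ∑ b ∈ T with r w b, columnWeight r S T b +
        ∑ b ∈ T', columnWeight r S T b := (sum_filter_add_sum_filter_not _ _ _).symm
    have e2 : ∑ a ∈ S, (if degreeIn r T a = 0 then Real.log 2 else 0) =
        ∑ a ∈ S.erase w, (if degreeIn r T a = 0 then Real.log 2 else 0) :=
      (sum_erase _ (by simp [hdeg.ne'])).symm
    have e3 := sum_congr rfl hcol
    rw [sum_sub_distrib] at e3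
    simp only [sum_filter (fun a => r a _)] at e3
    rw [sum_comm] at e3
    simp only [← sum_filter] at e3
    simp only [defect, sum_add_distrib,
      sum_sub_distrib (f := fun a => if degreeIn r T' a = 0 then Real.log 2 else 0)]
    rw [logCrossBound, logCrossBound, e1, e2, ← e3]
    ring
  have hgain : ∑ b ∈ T with r w b, ∑ a ∈ S.erase w with r a b, Real.log 2 / degreeIn r T a =
      ∑ a ∈ S.erase w, gain a := by
    simp only [sum_filter (fun a => r a _)]
    rw [sum_comm]
    refine sum_congr rfl fun a _ => ?_
    rw [← sum_filter, sum_const, nsmul_eq_mul, filter_filter]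
    have := degreeIn_filter_add (r := r) (T := T) (w := w) a
    simp only [gain]
    congr 2
    change _ = degreeIn r T a - degreeIn r {b ∈ T | ¬ r w b} a
    lia
  have hbound : bound = logCrossBound r S T - ∑ b ∈ T with r w b, columnWeight r S T b +
      ∑ a ∈ S.erase w, gain a := by
    simp only [bound, sum_sub_distrib]
    rw [hgain]
    ring
  have hrow : ∀ a ∈ S.erase w, defect a ≤ gain a ∧
      (0 < degreeIn r T' a → degreeIn r T' a < degreeIn r T a → defect a < gain a) ∧
      (degreeIn r T' a = 0 ∨ degreeIn r T' a = degreeIn r T a → defect a = gain a) := by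
    intro a ha
    refine sum_logEdgeWeight_sub_le {b ∈ T' | r a b} (degreeIn (flip r) S) (fun b hb => ?_) ?_
    · exact card_pos.2 ⟨a, mem_filter.2 ⟨mem_of_mem_erase ha, (mem_filter.1 hb).2⟩⟩
    · exact card_le_card (filter_subset_filter _ (filter_subset _ _))
  rw [hbound, hdefect]
  refine ⟨?_, ?_, ?_⟩
  · gcongr with a ha
    exact (hrow a ha).1
  · rintro ⟨a, ha, h0, h1⟩
    gcongr ?_ + ?_
    exact sum_lt_sum (fun a ha => (hrow a ha).1) ⟨a, ha, (hrow a ha).2.1 h0 h1⟩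
  · intro h
    rw [sum_congr rfl fun a ha => (hrow a ha).2.2 (h a ha)]

theorem columnWeight_eq (hw : w ∈ S) {b : β} (hwb : r w b) :
    columnWeight r S T b = logEdgeWeight (degreeIn r T w) (#{a ∈ S.erase w | r a b} + 1) +
      ∑ a ∈ S.erase w with r a b,
        logEdgeWeight (degreeIn r T a) (#{a ∈ S.erase w | r a b} + 1) := by
  rw [columnWeight, degreeIn_erase_add_one hw hwb, if_neg (by simp)]
  have : ({a ∈ S | r a b} : Finset α) = insert w {a ∈ S.erase w | r a b} := by
    conv_lhs => rw [← insert_erase hw, filter_insert, if_pos hwb]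
  rw [this, sum_insert (by simp)]

theorem exp_add_exp_columnWeight (hw : w ∈ S) (hdeg : 0 < degreeIn r T w)
    (hmax : ∀ a ∈ S, degreeIn r T a ≤ degreeIn r T w) {b : β} (hb : b ∈ T) (hwb : r w b) :
    let D : ℝ := degreeIn r T w
    let total : ℝ :=
      Real.exp (D * (columnWeight r (S.erase w) T b - columnWeight r S T b)) +
      Real.exp (D * (∑ a ∈ S.erase w with r a b, Real.log 2 / degreeIn r T a -
        columnWeight r S T b))
    total ≤ 1 ∧ ((∃ a ∈ S, r a b ∧ degreeIn r T a < degreeIn r T w) → total < 1) ∧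
      ((∀ a ∈ S, r a b → degreeIn r T a = degreeIn r T w) → total = 1) := by
  intro D total
  have key := exp_add_exp_sum_logEdgeWeight {a ∈ S.erase w | r a b} (degreeIn r T) hdeg
    (fun a ha => card_pos.2 ⟨b, mem_filter.2 ⟨hb, (mem_filter.1 ha).2⟩⟩)
    (fun a ha => hmax a (mem_of_mem_erase (mem_filter.1 ha).1))
  rw [← columnWeight_eq hw hwb] at key
  refine ⟨key.1, ?_, fun h => key.2.2 fun a ha =>
    h a (mem_of_mem_erase (mem_filter.1 ha).1) (mem_filter.1 ha).2⟩
  rintro ⟨a, ha, hab, h⟩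
  have hne : a ≠ w := by rintro rfl; exact h.ne rfl
  exact key.2.1 ⟨a, mem_filter.2 ⟨mem_erase.2 ⟨hne, ha⟩, hab⟩, h⟩

theorem numCrossIndep_eq_of_degreeIn_eq_zero (h : ∀ a ∈ S, degreeIn r T a = 0) :
    (numCrossIndep r S T : ℝ) = Real.exp (logCrossBound r S T) ∧ CrossClosed r S T := by
  have hno : ∀ a ∈ S, ∀ b ∈ T, ¬ r a b := fun a ha b hb hab => by
    have := card_eq_zero.1 (h a ha)
    exact notMem_empty b (this ▸ mem_filter.2 ⟨hb, hab⟩)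
  refine ⟨?_, fun a ha _ _ b hb _ _ hab => (hno a ha b hb hab).elim⟩
  have e1 : numCrossIndep r S T = 2 ^ #S * 2 ^ #T := by
    rw [numCrossIndep, sum_congr rfl (g := fun _ => 2 ^ #T), sum_const, card_powerset, smul_eq_mul]
    intro P hP
    rw [filter_true_of_mem fun b hb a ha => hno a (mem_powerset.1 hP ha) b hb]
  have e2 : logCrossBound r S T = #S * Real.log 2 + #T * Real.log 2 := by
    rw [logCrossBound, sum_congr rfl (g := fun _ => Real.log 2) fun a ha => by simp [h a ha],
      sum_congr (s₁ := T) rfl (g := fun _ => Real.log 2), sum_const, sum_const, nsmul_eq_mul,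
      nsmul_eq_mul]
    intro b hb
    rw [columnWeight, if_pos]
    exact card_eq_zero.2 (filter_eq_empty_iff.2 fun a ha => hno a ha b hb)
  rw [e1, e2, ← Real.log_pow, ← Real.log_pow, Real.exp_add, Real.exp_log (by positivity),
    Real.exp_log (by positivity)]
  push_cast
  rfl

theorem crossClosed_of_erase (hS : CrossClosed r (S.erase w) T)
    (h : ∀ a ∈ S, (∃ b ∈ T, r w b ∧ r a b) → ∀ b ∈ T, r a b ↔ r w b) : CrossClosed r S T := by
  intro a ha a' ha' b hb b' hb' h1 h2 h3
  by_cases haw : a = w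
  · subst haw
    exact (h a' ha' ⟨b, hb, h1, h2⟩ b' hb').1 h3
  by_cases haw' : a' = w
  · subst haw'
    exact (h a ha ⟨b, hb, h2, h1⟩ b' hb').2 h3
  exact hS a (mem_erase.2 ⟨haw, ha⟩) a' (mem_erase.2 ⟨haw', ha'⟩) b hb b' hb' h1 h2 h3

theorem CrossClosed.related_iff (h : CrossClosed r S T) {a a' : α} (ha : a ∈ S) (ha' : a' ∈ S)
    {b : β} (hb : b ∈ T) (hab : r a b) (hab' : r a' b) {b' : β} (hb' : b' ∈ T) :
    r a b' ↔ r a' b' :=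
  ⟨fun h' => h a' ha' a ha b hb b' hb' hab' hab h', fun h' => h a ha a' ha' b hb b' hb' hab hab' h'⟩

theorem numCrossIndep_le_exp_logCrossBound (r : α → β → Prop) (S : Finset α) (T : Finset β) :
    (numCrossIndep r S T : ℝ) ≤ Real.exp (logCrossBound r S T) ∧
      ((numCrossIndep r S T : ℝ) = Real.exp (logCrossBound r S T) ↔ CrossClosed r S T) := by
  induction S using Finset.strongInduction generalizing T with
  | H S ih =>
  by_cases hzero : ∀ a ∈ S, degreeIn r T a = 0
  · have := numCrossIndep_eq_of_degreeIn_eq_zero hzero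
    exact ⟨this.1.le, fun _ => this.2, fun _ => this.1⟩
  push Not at hzero
  obtain ⟨a₀, ha₀, hne⟩ := hzero
  obtain ⟨w, hw, hmax⟩ := exists_max_image S (degreeIn r T) ⟨a₀, ha₀⟩
  have hdeg : 0 < degreeIn r T w := (Nat.pos_of_ne_zero hne).trans_le (hmax a₀ ha₀)
  obtain ⟨hle₁, heq₁⟩ := ih (S.erase w) (erase_ssubset hw) T
  obtain ⟨hle₂, heq₂⟩ := ih (S.erase w) (erase_ssubset hw) {b ∈ T | ¬ r w b}
  have hbound₁ := logCrossBound_erase (S := S) hdeg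
  obtain ⟨hbound₂, hbound₂lt, hbound₂eq⟩ := logCrossBound_erase_filter (S := S) hdeg
  have hcol := fun b (hb : b ∈ ({b ∈ T | r w b} : Finset β)) =>
    exp_add_exp_columnWeight hw hdeg hmax (mem_filter.1 hb).1 (mem_filter.1 hb).2
  have hsne : ({b ∈ T | r w b} : Finset β).Nonempty := card_pos.1 hdeg
  obtain ⟨hsum, hsumlt⟩ := exp_sum_add_exp_sum_le_one hsne fun b hb => (hcol b hb).1
  set x : β → ℝ := fun b => columnWeight r (S.erase w) T b - columnWeight r S T b
  set y : β → ℝ := fun b =>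
    ∑ a ∈ S.erase w with r a b, Real.log 2 / degreeIn r T a - columnWeight r S T b
  set X := ∑ b ∈ T with r w b, x b
  set Y := ∑ b ∈ T with r w b, y b
  set J := logCrossBound r S T
  set J₁ := logCrossBound r (S.erase w) T
  set J₂ := logCrossBound r (S.erase w) {b ∈ T | ¬ r w b}
  have hsplit : (numCrossIndep r S T : ℝ) = numCrossIndep r (S.erase w) T +
      numCrossIndep r (S.erase w) {b ∈ T | ¬ r w b} := by
    rw [numCrossIndep_erase hw]; push_cast; rfl
  have hJ : 0 < Real.exp J := Real.exp_pos J
  have hJ₁ : Real.exp J₁ = Real.exp J * Real.exp X := by rw [hbound₁, Real.exp_add]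
  have hJ₂ : Real.exp J₂ ≤ Real.exp J * Real.exp Y := by
    rw [← Real.exp_add]; exact Real.exp_le_exp.2 hbound₂
  have hXY : Real.exp J * Real.exp X + Real.exp J * Real.exp Y ≤ Real.exp J := by
    rw [← mul_add]; exact mul_le_of_le_one_right hJ.le hsum
  refine ⟨by linarith, fun heq => ?_, fun hcl => ?_⟩
  · have hcl₁ : CrossClosed r (S.erase w) T := heq₁.1 (by linarith)
    have hfull : ∀ b ∈ T, r w b → ∀ a ∈ S, r a b → degreeIn r T a = degreeIn r T w := by
      intro b hb hwb a ha hab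
      by_contra hne
      have := hsumlt ⟨b, mem_filter.2 ⟨hb, hwb⟩, (hcol b (mem_filter.2 ⟨hb, hwb⟩)).2.1
        ⟨a, ha, hab, (hmax a ha).lt_of_ne hne⟩⟩
      have := mul_lt_mul_of_pos_left this hJ
      linarith
    have hextreme : ∀ a ∈ S.erase w, degreeIn r {b ∈ T | ¬ r w b} a < degreeIn r T a →
        degreeIn r {b ∈ T | ¬ r w b} a = 0 := by
      intro a ha hlt
      by_contra hpos
      have := Real.exp_lt_exp.2 (hbound₂lt ⟨a, ha, Nat.pos_of_ne_zero hpos, hlt⟩)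
      rw [Real.exp_add] at this
      linarith
    refine crossClosed_of_erase hcl₁ ?_
    rintro a ha ⟨b, hb, hwb, hab⟩
    by_cases haw : a = w
    · simp [haw]
    have hadd := degreeIn_filter_add (r := r) (T := T) (w := w) a
    have hpos : 0 < #{b ∈ T | r w b ∧ r a b} := card_pos.2 ⟨b, mem_filter.2 ⟨hb, hwb, hab⟩⟩
    have h0 := hextreme a (mem_erase.2 ⟨haw, ha⟩) (by lia)
    have hcard := hfull b hb hwb a ha hab
    have hsub : ({b ∈ T | r a b} : Finset β) ⊆ {b ∈ T | r w b} := by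
      intro c hc
      by_contra hcw
      simp only [mem_filter] at hc hcw
      exact notMem_empty c (card_eq_zero.1 h0 ▸
        mem_filter.2 ⟨mem_filter.2 ⟨hc.1, fun h => hcw ⟨hc.1, h⟩⟩, hc.2⟩)
    have hset := eq_of_subset_of_card_le hsub hcard.ge
    intro c hc
    have := Finset.ext_iff.1 hset c
    simpa [hc] using this
  · have hT₁ := heq₁.2 (hcl.mono (erase_subset _ _) Subset.rfl)
    have hT₂ := heq₂.2 (hcl.mono (erase_subset _ _) (filter_subset _ _))
    have hrel : ∀ b ∈ T, r w b → ∀ a ∈ S, r a b → ∀ c ∈ T, r a c ↔ r w c :=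
      fun b hb hwb a ha hab c hc => hcl.related_iff ha hw hb hab hwb hc
    have hdegeq : ∀ b ∈ T, r w b → ∀ a ∈ S, r a b → degreeIn r T a = degreeIn r T w :=
      fun b hb hwb a ha hab => congrArg card (filter_congr (hrel b hb hwb a ha hab))
    have hJ₂eq : J₂ = J + Y := by
      refine hbound₂eq fun a ha => ?_
      have hadd := degreeIn_filter_add (r := r) (T := T) (w := w) a
      rcases Nat.eq_zero_or_pos #{b ∈ T | r w b ∧ r a b} with h0 | hpos
      · right; lia
      · left
        obtain ⟨b, hb⟩ := card_pos.1 hpos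
        obtain ⟨hb, hwb, hab⟩ := mem_filter.1 hb
        refine card_eq_zero.2 (filter_eq_empty_iff.2 fun c hc hac => ?_)
        exact (mem_filter.1 hc).2
          ((hrel b hb hwb a (mem_of_mem_erase ha) hab c (mem_filter.1 hc).1).1 hac)
    obtain ⟨b₀, hb₀⟩ := hsne
    obtain ⟨hb₀T, hwb₀⟩ := mem_filter.1 hb₀
    have hnb : ∀ b ∈ ({b ∈ T | r w b} : Finset β), ∀ a ∈ S, r a b ↔ r a b₀ := by
      intro b hb a ha
      obtain ⟨hb, hwb⟩ := mem_filter.1 hb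
      exact ⟨fun h => hcl a ha w hw b hb b₀ hb₀T h hwb hwb₀,
        fun h => hcl a ha w hw b₀ hb₀T b hb h hwb₀ hwb⟩
    have hfilter : ∀ b ∈ ({b ∈ T | r w b} : Finset β), ∀ S' ⊆ S,
        ({a ∈ S' | r a b} : Finset α) = {a ∈ S' | r a b₀} :=
      fun b hb S' hS' => filter_congr fun a ha => hnb b hb a (hS' ha)
    have hcolumn : ∀ b ∈ ({b ∈ T | r w b} : Finset β), ∀ S' ⊆ S,
        columnWeight r S' T b = columnWeight r S' T b₀ := by
      intro b hb S' hS'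
      have hd : degreeIn (flip r) S' b = degreeIn (flip r) S' b₀ :=
        congrArg card (hfilter b hb S' hS')
      rw [columnWeight, columnWeight, hfilter b hb S' hS', hd]
    have hX : X = degreeIn r T w * x b₀ := by
      rw [show X = ∑ b ∈ T with r w b, x b₀ from sum_congr rfl fun b hb => by
        simp only [x, hcolumn b hb _ (erase_subset w S), hcolumn b hb S Subset.rfl],
        sum_const, nsmul_eq_mul, degreeIn]
    have hY : Y = degreeIn r T w * y b₀ := by
      rw [show Y = ∑ b ∈ T with r w b, y b₀ from sum_congr rfl fun b hb => by
        simp only [y, hfilter b hb _ (erase_subset w S), hcolumn b hb S Subset.rfl],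
        sum_const, nsmul_eq_mul, degreeIn]
    have hone : Real.exp X + Real.exp Y = 1 := by
      rw [hX, hY]
      exact (hcol b₀ hb₀).2.2 fun a ha hab => hdegeq b₀ hb₀T hwb₀ a ha hab
    rw [hsplit, hT₁, hT₂, hJ₁, hJ₂eq, Real.exp_add, ← mul_add, hone, mul_one]

end Bipartite

section Graph

variable {V : Type*}

/-- Every walk with three edges has adjacent endpoints. -/
def WalkClosed (G : SimpleGraph V) : Prop :=
  ∀ ⦃a b c d⦄, G.Adj a b → G.Adj b c → G.Adj c d → G.Adj a d

/-- The set `F` is one side of a bipartition of the subgraph of `G` induced on `W`. -/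
def IsSideOn (G : SimpleGraph V) (F W : Finset V) : Prop :=
  ∀ ⦃u⦄, u ∈ W → ∀ ⦃v⦄, v ∈ W → G.Adj u v → (u ∈ F ↔ v ∉ F)

/-- Exchange the two sets of a pair inside `F`. -/
noncomputable def swapInside (F : Finset V) (p : Finset V × Finset V) : Finset V × Finset V :=
  ((p.1 \ F) ∪ (p.2 ∩ F), (p.2 \ F) ∪ (p.1 ∩ F))

theorem swapInside_swapInside (F : Finset V) (p : Finset V × Finset V) :
    swapInside F (swapInside F p) = p := by
  ext x <;> simp only [swapInside, mem_union, mem_sdiff, mem_inter] <;> tauto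

theorem swapInside_union (F : Finset V) (p : Finset V × Finset V) :
    (swapInside F p).1 ∪ (swapInside F p).2 = p.1 ∪ p.2 := by
  ext x; simp only [swapInside, mem_union, mem_sdiff, mem_inter]; tauto

variable [Fintype V] (G : SimpleGraph V)

theorem numCrossIndep_univ : numCrossIndep G.Adj univ univ =
    #{p : Finset V × Finset V | ∀ a ∈ p.1, ∀ b ∈ p.2, ¬ G.Adj a b} := by
  rw [numCrossIndep, powerset_univ, card_filter, ← univ_product_univ, sum_product]
  refine sum_congr rfl fun P _ => ?_
  rw [← card_powerset, ← card_filter]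
  congr 1
  ext Q
  simp only [mem_powerset, subset_iff, mem_filter, mem_univ, true_and]
  exact ⟨fun h a ha b hb => h hb a ha, fun h b hb a ha => h a ha b hb⟩

theorem numIndepSets_sq : numIndepSets G ^ 2 =
    #{p : Finset V × Finset V | (∀ u ∈ p.1, ∀ v ∈ p.1, ¬ G.Adj u v) ∧
      ∀ u ∈ p.2, ∀ v ∈ p.2, ¬ G.Adj u v} := by
  rw [sq, numIndepSets, ← card_product, ← filter_product, univ_product_univ]

theorem numIndepSets_sq_le : numIndepSets G ^ 2 ≤ numCrossIndep G.Adj univ univ := by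
  rw [numIndepSets_sq, numCrossIndep_univ]
  let side : Finset V → Finset V := fun W =>
    if h : ∃ F, IsSideOn G F W then h.choose else ∅
  refine card_le_card_of_injOn (fun p => swapInside (side (p.1 ∪ p.2)) p) ?_ ?_
  · rintro ⟨A, B⟩ hp
    simp only [coe_filter, mem_univ, true_and, Set.mem_ofPred_eq] at hp ⊢
    obtain ⟨hA, hB⟩ := hp
    have hex : ∃ F, IsSideOn G F (A ∪ B) := by
      refine ⟨A, fun u hu v hv huv => ⟨fun h h' => hA u h v h' huv, fun h => ?_⟩⟩
      have hvB := (mem_union.1 hv).resolve_left h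
      exact (mem_union.1 hu).resolve_right fun huB => hB u huB v hvB huv
    have hside : IsSideOn G (side (A ∪ B)) (A ∪ B) := by
      simp only [side, dif_pos hex]; exact hex.choose_spec
    intro a ha b hb hab
    simp only [swapInside, mem_union, mem_sdiff, mem_inter] at ha hb
    have haW : a ∈ A ∪ B := mem_union.2 (ha.imp And.left And.left)
    have hbW : b ∈ A ∪ B := mem_union.2 (hb.imp And.left And.left).symm
    have hF := hside haW hbW hab
    rcases ha with ⟨ha, haF⟩ | ⟨ha, haF⟩
    · exact hA a ha b (hb.resolve_left fun h => haF (hF.2 h.2)).1 hab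
    · exact hB a ha b (hb.resolve_right fun h => hF.1 haF h.2).1 hab
  · intro p _ q _ h
    have hunion : p.1 ∪ p.2 = q.1 ∪ q.2 := by
      rw [← swapInside_union (side (p.1 ∪ p.2)) p, ← swapInside_union (side (q.1 ∪ q.2)) q]
      exact congrArg (fun x : Finset V × Finset V => x.1 ∪ x.2) h
    simp only [hunion] at h
    rw [← swapInside_swapInside (side (q.1 ∪ q.2)) p, h, swapInside_swapInside]

theorem numCrossIndep_le_numIndepSets_sq {G : SimpleGraph V} {F : Finset V}
    (hF : IsSideOn G F univ) : numCrossIndep G.Adj univ univ ≤ numIndepSets G ^ 2 := by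
  rw [numIndepSets_sq, numCrossIndep_univ]
  refine card_le_card_of_injOn (swapInside F) ?_
    (Function.LeftInverse.injective (swapInside_swapInside F)).injOn
  rintro ⟨A, B⟩ hp
  simp only [coe_filter, mem_univ, true_and, Set.mem_ofPred_eq] at hp ⊢
  constructor
  all_goals
    intro u hu v hv huv
    have h1 := hF (mem_univ u) (mem_univ v) huv
    have h2 : u ∈ A → v ∈ B → False := fun hu hv => hp u hu v hv huv
    have h3 : v ∈ A → u ∈ B → False := fun hv hu => hp v hv u hu huv.symm
    simp only [swapInside, mem_union, mem_sdiff, mem_inter] at hu hv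
    tauto

theorem crossClosed_univ_iff : CrossClosed G.Adj univ univ ↔ WalkClosed G :=
  ⟨fun h a b c d hab hbc hcd => h a (mem_univ _) c (mem_univ _) b (mem_univ _) d (mem_univ _)
    hab hbc.symm hcd, fun h _ _ _ _ _ _ _ _ h1 h2 h3 => h h1 h2.symm h3⟩

theorem degreeIn_univ (v : V) : degreeIn G.Adj univ v = G.degree v := by
  rw [degreeIn, ← G.card_neighborFinset_eq_degree, G.neighborFinset_eq_filter]

theorem degreeIn_flip_univ (v : V) : degreeIn (flip G.Adj) univ v = G.degree v := by
  rw [← degreeIn_univ, show flip G.Adj = G.Adj from funext₂ fun a b => propext (G.adj_comm b a)]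

theorem columnWeight_univ (v : V) : columnWeight G.Adj univ univ v =
    (if G.degree v = 0 then Real.log 2 else 0) +
      ∑ u with G.Adj u v, logEdgeWeight (G.degree u) (G.degree v) := by
  rw [columnWeight, degreeIn_flip_univ]
  split_ifs with h
  · have : ({u | G.Adj u v} : Finset V) = ∅ := by
      rw [← degreeIn_flip_univ] at h
      exact card_eq_zero.1 h
    rw [this, sum_empty, add_zero]
  · simp only [degreeIn_univ, zero_add]

theorem sum_adj_eq_two_mul_sum_edgeFinset (f : Sym2 V → ℝ) :
    ∑ v, ∑ u with G.Adj u v, f s(u, v) = 2 * ∑ e ∈ G.edgeFinset, f e := by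
  simp only [sum_filter]
  rw [← sum_product', univ_product_univ,
    ← sum_filter (fun p : V × V => G.Adj p.2 p.1) (fun p => f s(p.2, p.1)),
    ← sum_fiberwise_of_maps_to (t := G.edgeFinset) (g := fun p : V × V => s(p.2, p.1))
      fun p hp => by simpa using hp, mul_sum]
  refine sum_congr rfl fun e he => ?_
  induction e with
  | h u v =>
    rw [SimpleGraph.mem_edgeFinset, SimpleGraph.mem_edgeSet] at he
    have hfib : ({p ∈ ({p | G.Adj p.2 p.1} : Finset (V × V)) | s(p.2, p.1) = s(u, v)}) =
        {(u, v), (v, u)} := by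
      ext ⟨x, y⟩
      simp only [mem_filter, mem_univ, true_and, mem_insert, mem_singleton, Sym2.eq_iff,
        Prod.mk.injEq]
      constructor
      · tauto
      · rintro (⟨rfl, rfl⟩ | ⟨rfl, rfl⟩)
        · exact ⟨he.symm, Or.inr ⟨rfl, rfl⟩⟩
        · exact ⟨he, Or.inl ⟨rfl, rfl⟩⟩
    rw [hfib, sum_pair (by simp [he.ne]), Sym2.eq_swap, two_mul]

theorem edgeWeight_mk (u v : V) : edgeWeight G s(u, v) =
    ((2 : ℝ) ^ G.degree u + 2 ^ G.degree v - 1) ^ ((1 : ℝ) / (G.degree u * G.degree v)) := rfl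

theorem edgeWeight_eq_exp {u v : V} (h : G.Adj u v) :
    edgeWeight G s(u, v) = Real.exp (logEdgeWeight (G.degree u) (G.degree v)) := by
  rw [edgeWeight_mk, exp_logEdgeWeight]
  exact (G.degree_pos_iff_exists_adj u).2 ⟨v, h⟩

theorem edgeWeight_pos {e : Sym2 V} (he : e ∈ G.edgeFinset) : 0 < edgeWeight G e := by
  induction e with
  | h u v =>
    rw [SimpleGraph.mem_edgeFinset, SimpleGraph.mem_edgeSet] at he
    rw [edgeWeight_eq_exp G he]
    exact Real.exp_pos _

theorem exp_logCrossBound_univ : Real.exp (logCrossBound G.Adj univ univ) =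
    (2 ^ numIsolated G * ∏ e ∈ G.edgeFinset, edgeWeight G e) ^ 2 := by
  have hiso : ∑ v, (if G.degree v = 0 then Real.log 2 else 0) = numIsolated G * Real.log 2 := by
    rw [← sum_filter, sum_const, nsmul_eq_mul, numIsolated]
  have hedge : ∑ v, ∑ u with G.Adj u v, logEdgeWeight (G.degree u) (G.degree v) =
      2 * ∑ e ∈ G.edgeFinset, Real.log (edgeWeight G e) := by
    rw [← sum_adj_eq_two_mul_sum_edgeFinset]
    refine sum_congr rfl fun v _ => sum_congr rfl fun u hu => ?_
    rw [edgeWeight_eq_exp G (mem_filter.1 hu).2, Real.log_exp]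
  have hprod : ∏ e ∈ G.edgeFinset, edgeWeight G e =
      Real.exp (∑ e ∈ G.edgeFinset, Real.log (edgeWeight G e)) := by
    rw [Real.exp_sum]
    exact prod_congr rfl fun e he => (Real.exp_log (edgeWeight_pos G he)).symm
  have htwo : (2 : ℝ) ^ numIsolated G = Real.exp (numIsolated G * Real.log 2) := by
    rw [← Real.log_pow, Real.exp_log (by positivity)]
  simp only [logCrossBound, columnWeight_univ, degreeIn_univ, sum_add_distrib]
  rw [hiso, hedge, hprod, htwo, ← Real.exp_add, sq, ← Real.exp_add]
  congr 1
  ring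

end Graph

section Structure

variable {V : Type*} {G : SimpleGraph V}

theorem WalkClosed.eq_or_adj_of_reachable (h : WalkClosed G) {x u : V} (hxu : G.Reachable x u) :
    x = u ∨ G.Adj x u ∨ ∃ z, G.Adj x z ∧ G.Adj z u := by
  rw [SimpleGraph.reachable_iff_reflTransGen] at hxu
  induction hxu with
  | refl => exact Or.inl rfl
  | @tail u v _ huv ih =>
    rcases ih with rfl | hxu | ⟨z, hxz, hzu⟩
    · exact Or.inr (Or.inl huv)
    · exact Or.inr (Or.inr ⟨u, hxu, huv⟩)
    · exact Or.inr (Or.inl (h hxz hzu huv))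

/-- The vertices adjacent to the chosen representative of their component. -/
def representativeNeighbors (G : SimpleGraph V) : Set V :=
  {v | G.Adj (G.connectedComponentMk v).out v}

theorem reachable_representative (v : V) : G.Reachable (G.connectedComponentMk v).out v :=
  SimpleGraph.ConnectedComponent.exact (Quot.out_eq _)

theorem WalkClosed.mem_representativeNeighbors_iff (h : WalkClosed G) {u v : V}
    (huv : G.connectedComponentMk u = G.connectedComponentMk v) :
    G.Adj u v ↔ (u ∈ representativeNeighbors G ↔ v ∉ representativeNeighbors G) := by
  have hu := reachable_representative (G := G) u
  have hv := reachable_representative (G := G) v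
  simp only [representativeNeighbors, Set.mem_ofPred_eq, huv] at hu hv ⊢
  set x := (G.connectedComponentMk v).out
  have hside : ∀ {p q : V}, G.Reachable x p → G.Adj x q → ¬ G.Adj x p → G.Adj q p := by
    intro p q hp hq hnp
    rcases h.eq_or_adj_of_reachable hp with rfl | hp | ⟨z, hxz, hzp⟩
    · exact hq.symm
    · exact (hnp hp).elim
    · exact h hq.symm hxz hzp
  constructor
  · intro hadj
    refine ⟨fun h1 h2 => G.loopless.irrefl x (h h1 hadj h2.symm), fun h1 => ?_⟩
    rcases h.eq_or_adj_of_reachable hu with rfl | hxu | ⟨z, hxz, hzu⟩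
    · exact (h1 hadj).elim
    · exact hxu
    · exact (h1 (h hxz hzu hadj)).elim
  · intro hiff
    by_cases hxu : G.Adj x u
    · exact hside hv hxu (hiff.1 hxu)
    · exact (hside hu (not_not.1 fun hxv => hxu (hiff.2 hxv)) hxu).symm

theorem WalkClosed.exists_isSideOn [Fintype V] (h : WalkClosed G) : ∃ F, IsSideOn G F univ := by
  refine ⟨univ.filter (· ∈ representativeNeighbors G), fun u _ v _ huv => ?_⟩
  simpa using (h.mem_representativeNeighbors_iff
    (SimpleGraph.ConnectedComponent.sound huv.reachable)).1 huv

theorem WalkClosed.isDisjUnion [Finite V] (h : WalkClosed G) :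
    IsDisjUnionCompleteBipartiteAndIsolated G := by
  intro C
  let W : Set V := {v | G.connectedComponentMk v = C}
  let p : W → Prop := fun v => (v : V) ∈ representativeNeighbors G
  let e₁ := Finite.equivFin {v : W // p v}
  let e₂ := Finite.equivFin {v : W // ¬ p v}
  refine ⟨_, _, ⟨⟨(Equiv.sumCompl p).symm.trans (Equiv.sumCongr e₁ e₂), ?_⟩⟩⟩
  intro u v
  have hadj : G.Adj u v ↔ (p u ↔ ¬ p v) :=
    h.mem_representativeNeighbors_iff (u.2.trans v.2.symm)
  rw [SimpleGraph.comap_adj]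
  refine Iff.trans ?_ hadj.symm
  by_cases hu : p u <;> by_cases hv : p v <;> simp [hu, hv]

theorem IsDisjUnionCompleteBipartiteAndIsolated.walkClosed
    (h : IsDisjUnionCompleteBipartiteAndIsolated G) : WalkClosed G := by
  intro a b c d hab hbc hcd
  obtain ⟨m, n, ⟨e⟩⟩ := h (G.connectedComponentMk a)
  have hb : G.connectedComponentMk b = G.connectedComponentMk a :=
    SimpleGraph.ConnectedComponent.sound hab.symm.reachable
  have hc : G.connectedComponentMk c = G.connectedComponentMk a :=
    (SimpleGraph.ConnectedComponent.sound hbc.symm.reachable).trans hb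
  have hd : G.connectedComponentMk d = G.connectedComponentMk a :=
    (SimpleGraph.ConnectedComponent.sound hcd.symm.reachable).trans hc
  let W : Set V := {v | G.connectedComponentMk v = G.connectedComponentMk a}
  have key : ∀ x y : W, G.Adj x y ↔ (completeBipartiteGraph (Fin m) (Fin n)).Adj (e x) (e y) :=
    fun x y => e.map_rel_iff.symm
  have h1 := (key ⟨a, rfl⟩ ⟨b, hb⟩).1 hab
  have h2 := (key ⟨b, hb⟩ ⟨c, hc⟩).1 hbc
  have h3 := (key ⟨c, hc⟩ ⟨d, hd⟩).1 hcd
  refine (key ⟨a, rfl⟩ ⟨d, hd⟩).2 ?_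
  revert h1 h2 h3
  generalize e ⟨a, rfl⟩ = a'
  generalize e ⟨b, hb⟩ = b'
  generalize e ⟨c, hc⟩ = c'
  generalize e ⟨d, hd⟩ = d'
  rcases a' with _ | _ <;> rcases b' with _ | _ <;> rcases c' with _ | _ <;>
    rcases d' with _ | _ <;> simp [completeBipartiteGraph]

theorem walkClosed_iff_isDisjUnion [Finite V] :
    WalkClosed G ↔ IsDisjUnionCompleteBipartiteAndIsolated G :=
  ⟨WalkClosed.isDisjUnion, IsDisjUnionCompleteBipartiteAndIsolated.walkClosed⟩

end Structure

/-- **Sah–Sawhney–Stoner–Zhao.** For every graph `G`,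
`i(G) ≤ 2^{iso(G)} ∏_{uv ∈ E(G)} (2^{d_u} + 2^{d_v} - 1)^{1/(d_u d_v)}`, with equality
iff `G` is a disjoint union of complete bipartite graphs and isolated vertices. -/
theorem independent_sets_upper_bound_iso {V : Type*} [Fintype V] (G : SimpleGraph V) :
    (numIndepSets G : ℝ) ≤ 2 ^ numIsolated G * ∏ e ∈ G.edgeFinset, edgeWeight G e ∧
      ((numIndepSets G : ℝ) = 2 ^ numIsolated G * ∏ e ∈ G.edgeFinset, edgeWeight G e ↔
        IsDisjUnionCompleteBipartiteAndIsolated G) := by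
  obtain ⟨hle, heq⟩ := numCrossIndep_le_exp_logCrossBound G.Adj univ univ
  rw [exp_logCrossBound_univ, crossClosed_univ_iff] at heq
  rw [exp_logCrossBound_univ] at hle
  have hJ : 0 ≤ 2 ^ numIsolated G * ∏ e ∈ G.edgeFinset, edgeWeight G e :=
    mul_nonneg (by positivity) (prod_nonneg fun e he => (edgeWeight_pos G he).le)
  set J : ℝ := 2 ^ numIsolated G * ∏ e ∈ G.edgeFinset, edgeWeight G e
  have hi : (0 : ℝ) ≤ numIndepSets G := Nat.cast_nonneg _
  have hsq : (numIndepSets G : ℝ) ^ 2 ≤ numCrossIndep G.Adj univ univ := by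
    exact_mod_cast numIndepSets_sq_le G
  refine ⟨(sq_le_sq₀ hi hJ).1 (hsq.trans hle), ?_⟩
  rw [← walkClosed_iff_isDisjUnion, ← sq_eq_sq₀ hi hJ]
  refine ⟨fun h => heq.1 (hle.antisymm (h ▸ hsq)), fun h => ?_⟩
  obtain ⟨F, hF⟩ := h.exists_isSideOn
  have hsq' : (numCrossIndep G.Adj univ univ : ℝ) ≤ (numIndepSets G : ℝ) ^ 2 := by
    exact_mod_cast numCrossIndep_le_numIndepSets_sq hF
  exact (hsq.antisymm hsq').trans (heq.2 h)
end

section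
/- Let G be a finite simple graph and let d_v denote the degree of vertex v in G. Then the number of independent sets of G satisfies i(G) ≥ ∏_{v ∈ V(G)} (d_v + 2)^{1/(d_v + 1)}, where the product is over all vertices of G. Moreover, equality holds if and only if G is a disjoint union of cliques (i.e., every connected component of G is a complete graph). -/
open Finset
open scoped Classical

/-- `G` is a disjoint union of cliques: any two distinct vertices in the same connected
component are adjacent, i.e. every connected component is a complete graph. -/
def IsDisjUnionOfCliques {V : Type*} (G : SimpleGraph V) : Prop :=
  ∀ u v : V, G.Reachable u v → u ≠ v → G.Adj u v

/-- The logarithm `log (d + 2) / (d + 1)` of the contribution of a vertex of degree `d`. -/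
noncomputable def logWeight (d : ℕ) : ℝ := Real.log ((d : ℝ) + 2) / ((d : ℝ) + 1)

/-- The contribution `(d + 2) ^ (1 / (d + 1))` of a vertex of degree `d`. -/
noncomputable def weight (d : ℕ) : ℝ := ((d : ℝ) + 2) ^ ((1 : ℝ) / ((d : ℝ) + 1))

lemma weight_eq_exp (d : ℕ) : weight d = Real.exp (logWeight d) := by
  rw [weight, logWeight, Real.rpow_def_of_pos (by positivity)]
  ring_nf

lemma weight_pos (d : ℕ) : 0 < weight d := by
  rw [weight_eq_exp]
  exact Real.exp_pos _

lemma log_le_half_sub_inv {y : ℝ} (hy : 1 ≤ y) : Real.log y ≤ (y - y⁻¹) / 2 := by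
  rw [← Real.sinh_log (by linarith)]
  exact Real.self_le_sinh_iff.2 (Real.log_nonneg hy)

lemma log_three_lower : (21 / 20 : ℝ) ≤ Real.log 3 := by
  have h : (21 : ℝ) ≤ Real.log (3 ^ 20) := by
    rw [Real.le_log_iff_exp_le (by positivity)]
    have h1 : Real.exp 21 = Real.exp 1 ^ 21 := by
      rw [← Real.exp_nat_mul]
      norm_num
    rw [h1]
    calc Real.exp 1 ^ 21 ≤ (2.72 : ℝ) ^ 21 := by
          gcongr
          linarith [Real.exp_one_lt_d9]
      _ ≤ 3 ^ 20 := by norm_num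
  rw [Real.log_pow] at h
  norm_num at h
  linarith

lemma log_add_one_lower {x : ℝ} (hx : 0 < x) :
    Real.log x + 2 / (2 * x + 1) ≤ Real.log (x + 1) := by
  have h := Real.le_log_one_add_of_nonneg (x := 1 / x) (by positivity)
  have h1 : 1 + 1 / x = (x + 1) / x := by field_simp
  have h2 : 2 * (1 / x) / (1 / x + 2) = 2 / (2 * x + 1) := by
    field_simp
    ring
  rw [h1, h2, Real.log_div (by positivity) (by positivity)] at h
  linarith

lemma log_sub_one_lower {x : ℝ} (hx : 1 < x) :
    Real.log x - (2 * x - 1) / (2 * x * (x - 1)) ≤ Real.log (x - 1) := by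
  have hx1 : 0 < x - 1 := by linarith
  have h := log_le_half_sub_inv (y := x / (x - 1)) (by
    rw [le_div_iff₀ hx1]
    linarith)
  have h2 : (x / (x - 1) - (x / (x - 1))⁻¹) / 2 = (2 * x - 1) / (2 * x * (x - 1)) := by
    have : x ≠ 0 := by positivity
    field_simp
    ring
  rw [h2, Real.log_div (by positivity) (by positivity)] at h
  linarith

lemma log_lower_of_three_le {x : ℝ} (hx : 3 ≤ x) :
    (4 * x ^ 2 + 3 / 2 * x - 4) / ((2 * x + 1) * (x + 2)) < Real.log x := by
  have h := Real.le_log_one_add_of_nonneg (x := (x - 3) / 3) (by linarith)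
  have h1 : 1 + (x - 3) / 3 = x / 3 := by ring
  have h2 : 2 * ((x - 3) / 3) / ((x - 3) / 3 + 2) = 2 * (x - 3) / (x + 3) := by
    have : (x - 3) / 3 + 2 = (x + 3) / 3 := by ring
    rw [this]
    field_simp
  rw [h1, h2, Real.log_div (by positivity) (by positivity)] at h
  have h3 : (4 * x ^ 2 + 3 / 2 * x - 4) / ((2 * x + 1) * (x + 2)) <
      21 / 20 + 2 * (x - 3) / (x + 3) := by
    have : 21 / 20 + 2 * (x - 3) / (x + 3) = (61 * x - 57) / (20 * (x + 3)) := by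
      field_simp
      ring
    rw [this, div_lt_div_iff₀ (by positivity) (by positivity)]
    obtain ⟨y, rfl⟩ : ∃ y, x = y + 3 := ⟨x - 3, by ring⟩
    have hy : 0 ≤ y := by linarith
    ring_nf
    nlinarith [pow_nonneg hy 2, pow_nonneg hy 3]
  linarith [log_three_lower]

lemma log_combination_pos {x : ℝ} (hx : 3 ≤ x) :
    0 < x / (x - 2) * Real.log (x - 1) - (2 * x + 1) / (x - 1) * Real.log x
      + (x + 1) / x * Real.log (x + 1) := by
  have hx2 : 0 < x - 2 := by linarith
  have hx1 : 0 < x - 1 := by linarith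
  have hx0 : 0 < x := by linarith
  have h1 := mul_le_mul_of_nonneg_left (log_sub_one_lower (x := x) (by linarith))
    (show 0 ≤ x / (x - 2) by positivity)
  have h2 := mul_le_mul_of_nonneg_left (log_add_one_lower hx0)
    (show 0 ≤ (x + 1) / x by positivity)
  have h3 := mul_lt_mul_of_pos_left (log_lower_of_three_le hx)
    (show 0 < (x + 2) / (x * (x - 1) * (x - 2)) by positivity)
  generalize Real.log x = L at *
  have h4 : x / (x - 2) * (L - (2 * x - 1) / (2 * x * (x - 1))) - (2 * x + 1) / (x - 1) * L
      + (x + 1) / x * (L + 2 / (2 * x + 1)) =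
      (x + 2) / (x * (x - 1) * (x - 2)) * L - (x + 2) / (x * (x - 1) * (x - 2)) *
        ((4 * x ^ 2 + 3 / 2 * x - 4) / ((2 * x + 1) * (x + 2))) := by
    field_simp
    ring
  linarith

lemma logWeight_strictAnti : StrictAnti logWeight := by
  refine strictAnti_nat_of_succ_lt fun n => ?_
  have h := Real.log_lt_sub_one_of_pos (show (0 : ℝ) < (n + 3) / (n + 2) by positivity)
    (by rw [Ne, div_eq_one_iff_eq (by positivity)]; linarith)
  have h1 : ((n : ℝ) + 3) / (n + 2) - 1 = ((n : ℝ) + 2)⁻¹ := by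
    field_simp
    ring
  rw [Real.log_div (by positivity) (by positivity), h1] at h
  have h2 := Real.one_sub_inv_le_log_of_pos (show (0 : ℝ) < n + 2 by positivity)
  have h3 := mul_lt_mul_of_pos_left h (show (0 : ℝ) < n + 1 by positivity)
  have h4 : ((n : ℝ) + 1) * ((n : ℝ) + 2)⁻¹ = 1 - ((n : ℝ) + 2)⁻¹ := by
    field_simp
    ring
  simp only [logWeight]
  push_cast
  have e : (n : ℝ) + 1 + 2 = n + 3 := by ring
  rw [e, div_lt_div_iff₀ (by positivity) (by positivity)]
  linarith

lemma logWeight_sub_ratio (n : ℕ) :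
    ((n : ℝ) + 4) * (logWeight (n + 1) - logWeight (n + 2)) <
      ((n : ℝ) + 3) * (logWeight n - logWeight (n + 1)) := by
  have h := log_combination_pos (x := (n : ℝ) + 3) (by linarith [n.cast_nonneg (α := ℝ)])
  simp only [logWeight]
  push_cast
  have e1 : (n : ℝ) + 3 - 1 = n + 2 := by ring
  have e2 : (n : ℝ) + 3 - 2 = n + 1 := by ring
  have e3 : (n : ℝ) + 3 + 1 = n + 4 := by ring
  have e4 : (n : ℝ) + 1 + 2 = n + 3 := by ring
  have e5 : (n : ℝ) + 2 + 2 = n + 4 := by ring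
  have e6 : (n : ℝ) + 1 + 1 = n + 2 := by ring
  have e7 : (n : ℝ) + 2 + 1 = n + 3 := by ring
  rw [e1, e2, e3] at h
  rw [e4, e5, e6, e7]
  have e8 : ((n : ℝ) + 3) * (Real.log (n + 2) / (n + 1) - Real.log (n + 3) / (n + 2)) -
      (n + 4) * (Real.log (n + 3) / (n + 2) - Real.log (n + 4) / (n + 3)) =
      (n + 3) / (n + 1) * Real.log (n + 2) - (2 * (n + 3) + 1) / (n + 2) * Real.log (n + 3)
        + (n + 4) / (n + 3) * Real.log (n + 4) := by
    ring
  linarith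

/-- For fixed `D`, the function `d ↦ (D + 2) * logWeight d - (D + 3) * logWeight (d + 1)` is
larger at every `d < D` than at `D`. -/
lemma logWeight_combination_lt {D d : ℕ} (h : d < D) :
    ((D : ℝ) + 2) * logWeight D - ((D : ℝ) + 3) * logWeight (D + 1) <
      ((D : ℝ) + 2) * logWeight d - ((D : ℝ) + 3) * logWeight (d + 1) := by
  have step : ∀ e, e < D →
      ((D : ℝ) + 2) * logWeight (e + 1) - ((D : ℝ) + 3) * logWeight (e + 2) <
        ((D : ℝ) + 2) * logWeight e - ((D : ℝ) + 3) * logWeight (e + 1) := by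
    intro e he
    have h1 := logWeight_sub_ratio e
    have h2 : logWeight (e + 2) < logWeight (e + 1) := logWeight_strictAnti (by omega)
    have h3 : ((e : ℝ) + 1) ≤ D := by exact_mod_cast he
    have h4 : 0 < (logWeight e - logWeight (e + 1)) - (logWeight (e + 1) - logWeight (e + 2)) := by
      by_contra! h5
      nlinarith
    nlinarith
  suffices ∀ m, d < m → m ≤ D →
      ((D : ℝ) + 2) * logWeight m - ((D : ℝ) + 3) * logWeight (m + 1) <
        ((D : ℝ) + 2) * logWeight d - ((D : ℝ) + 3) * logWeight (d + 1) from this D h le_rfl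
  intro m hm
  induction m, hm using Nat.le_induction with
  | base => exact fun hD => step d hD
  | succ m hm ih => exact fun hD => (step m hD).trans (ih (by omega))

lemma exp_add_one_lower (D : ℕ) (X : ℝ) :
    Real.exp (Real.log ((D : ℝ) + 2) + (D + 1) / (D + 2) * (X - Real.log (D + 1))) ≤
      Real.exp X + 1 := by
  have hc := convexOn_exp.2 (Set.mem_univ (X - Real.log ((D : ℝ) + 1))) (Set.mem_univ 0)
    (show (0 : ℝ) ≤ (D + 1) / (D + 2) by positivity) (show (0 : ℝ) ≤ 1 / (D + 2) by positivity)
    (by field_simp; ring)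
  simp only [smul_eq_mul, mul_zero, add_zero, Real.exp_zero, mul_one] at hc
  rw [Real.exp_sub, Real.exp_log (by positivity)] at hc
  rw [Real.exp_add, Real.exp_log (by positivity)]
  calc _ ≤ ((D : ℝ) + 2) * ((D + 1) / (D + 2) * (Real.exp X / (D + 1)) + 1 / (D + 2)) := by
        gcongr
    _ = _ := by field_simp

lemma succ_mul_logWeight (D : ℕ) : ((D : ℝ) + 1) * logWeight D = Real.log (D + 2) := by
  rw [logWeight]
  field_simp

lemma logWeight_sum_le {V : Type*} (N : Finset V) (d : V → ℕ)
    (h1 : ∀ u ∈ N, 1 ≤ d u) (h2 : ∀ u ∈ N, d u ≤ N.card) :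
    let L := logWeight N.card + ∑ u ∈ N, logWeight (d u)
    let R := Real.log ((N.card : ℝ) + 2) + (N.card + 1) / (N.card + 2) *
      (∑ u ∈ N, logWeight (d u - 1) - Real.log (N.card + 1))
    L ≤ R ∧ ((∃ u ∈ N, d u ≠ N.card) → L < R) := by
  intro L R
  obtain hN | ⟨D, hD⟩ : N.card = 0 ∨ ∃ D, N.card = D + 1 := by
    cases h : N.card <;> simp
  · obtain rfl := Finset.card_eq_zero.1 hN
    simp [L, R, logWeight]
  have key : R - L = (∑ u ∈ N, ((((D : ℝ) + 2) * logWeight (d u - 1)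
      - ((D : ℝ) + 3) * logWeight (d u)) - (((D : ℝ) + 2) * logWeight D
      - ((D : ℝ) + 3) * logWeight (D + 1)))) / (D + 3) := by
    have a1 := succ_mul_logWeight (D + 1)
    have a2 := succ_mul_logWeight D
    simp only [R, L, Finset.sum_sub_distrib, ← Finset.mul_sum, Finset.sum_const, hD, nsmul_eq_mul]
    push_cast at a1 ⊢
    have e1 : (D : ℝ) + 1 + 1 = D + 2 := by ring
    rw [e1] at a1 ⊢
    rw [← a1, ← a2]
    field_simp
    ring
  have term : ∀ u ∈ N, 0 ≤ ((((D : ℝ) + 2) * logWeight (d u - 1)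
      - ((D : ℝ) + 3) * logWeight (d u)) - (((D : ℝ) + 2) * logWeight D
      - ((D : ℝ) + 3) * logWeight (D + 1))) ∧ (d u ≠ N.card →
      0 < ((((D : ℝ) + 2) * logWeight (d u - 1)
      - ((D : ℝ) + 3) * logWeight (d u)) - (((D : ℝ) + 2) * logWeight D
      - ((D : ℝ) + 3) * logWeight (D + 1)))) := by
    intro u hu
    have hu1 := h1 u hu
    have hu2 := h2 u hu
    obtain ⟨e, he⟩ : ∃ e, d u = e + 1 := ⟨d u - 1, by omega⟩
    rw [he, hD, Nat.add_sub_cancel]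
    rcases lt_or_ge e D with h | h
    · have := logWeight_combination_lt h
      exact ⟨by linarith, fun _ => by linarith⟩
    · obtain rfl : e = D := by omega
      simp
  constructor
  · have : 0 ≤ R - L := by
      rw [key]
      exact div_nonneg (Finset.sum_nonneg fun u hu => (term u hu).1) (by positivity)
    linarith
  · rintro ⟨u, hu, hne⟩
    have : 0 < R - L := by
      rw [key]
      exact div_pos (Finset.sum_pos' (fun u hu => (term u hu).1) ⟨u, hu, (term u hu).2 hne⟩)
        (by positivity)
    linarith

lemma weight_mul_prod_le {V : Type*} (N : Finset V) (d : V → ℕ)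
    (h1 : ∀ u ∈ N, 1 ≤ d u) (h2 : ∀ u ∈ N, d u ≤ N.card) :
    weight N.card * ∏ u ∈ N, weight (d u) ≤ ∏ u ∈ N, weight (d u - 1) + 1 ∧
      (weight N.card * ∏ u ∈ N, weight (d u) = ∏ u ∈ N, weight (d u - 1) + 1 ↔
        ∀ u ∈ N, d u = N.card) := by
  obtain ⟨hle, hlt⟩ := logWeight_sum_le N d h1 h2
  have hexp := exp_add_one_lower N.card (∑ u ∈ N, logWeight (d u - 1))
  have eL : weight N.card * ∏ u ∈ N, weight (d u) =
      Real.exp (logWeight N.card + ∑ u ∈ N, logWeight (d u)) := by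
    simp only [weight_eq_exp, Real.exp_add, Real.exp_sum]
  have eR : ∏ u ∈ N, weight (d u - 1) = Real.exp (∑ u ∈ N, logWeight (d u - 1)) := by
    simp only [weight_eq_exp, Real.exp_sum]
  refine ⟨?_, fun h => ?_, fun h => ?_⟩
  · rw [eL, eR]
    exact (Real.exp_le_exp.2 hle).trans hexp
  · by_contra! hne
    rw [eL, eR] at h
    exact absurd h ((Real.exp_lt_exp.2 (hlt hne)).trans_le hexp).ne
  · rw [Finset.prod_congr rfl fun u hu => by rw [h u hu],
      Finset.prod_congr rfl fun u hu => show weight (d u - 1) = weight (N.card - 1) by rw [h u hu]]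
    simp only [Finset.prod_const, weight_eq_exp, ← Real.exp_nat_mul, ← Real.exp_add]
    cases hN : N.card with
    | zero => norm_num [logWeight, Real.exp_log]
    | succ D =>
      have a1 := succ_mul_logWeight (D + 1)
      have a2 := succ_mul_logWeight D
      have e : logWeight (D + 1) + ((D + 1 : ℕ) : ℝ) * logWeight (D + 1) =
          Real.log ((D + 1 : ℕ) + 2) := by
        rw [← a1]
        ring
      rw [e, Nat.add_sub_cancel, Nat.cast_add_one, a2, Real.exp_log (by positivity),
        Real.exp_log (by positivity)]
      ring

/-- The number of independent sets of `G` contained in `s`. -/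
noncomputable def indepCountOn {V : Type*} (G : SimpleGraph V) (s : Finset V) : ℕ :=
  (s.powerset.filter fun S : Finset V => ∀ u ∈ S, ∀ v ∈ S, ¬ G.Adj u v).card

/-- The degree of `v` into `s`. -/
noncomputable def degreeOn {V : Type*} (G : SimpleGraph V) (s : Finset V) (v : V) : ℕ :=
  (s.filter (G.Adj v)).card

/-- Adjacency of `G` is transitive on distinct vertices of `s`. -/
def IsClusterOn {V : Type*} (G : SimpleGraph V) (s : Finset V) : Prop :=
  ∀ a ∈ s, ∀ b ∈ s, ∀ c ∈ s, G.Adj a b → G.Adj b c → a ≠ c → G.Adj a c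

lemma IsClusterOn.mono {V : Type*} {G : SimpleGraph V} {s t : Finset V} (h : IsClusterOn G s)
    (hts : t ⊆ s) : IsClusterOn G t :=
  fun a ha b hb c hc => h a (hts ha) b (hts hb) c (hts hc)

lemma degreeOn_mono {V : Type*} (G : SimpleGraph V) {s t : Finset V} (hts : t ⊆ s) (v : V) :
    degreeOn G t v ≤ degreeOn G s v :=
  Finset.card_le_card (Finset.filter_subset_filter _ hts)

/-- Independent sets inside `s` either avoid `v` or contain `v` and avoid its neighbours. -/
lemma indepCountOn_split {V : Type*} (G : SimpleGraph V) {s : Finset V} {v : V} (hv : v ∈ s) :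
    indepCountOn G s = indepCountOn G (s.erase v) +
      indepCountOn G ((s.erase v).filter fun u => ¬ G.Adj v u) := by
  unfold indepCountOn
  rw [← Finset.card_filter_add_card_filter_not (s := s.powerset.filter _) (fun S => v ∉ S)]
  congr 1
  · congr 1
    ext S
    simp only [Finset.mem_filter, Finset.mem_powerset, Finset.subset_erase]
    tauto
  · refine Finset.card_bij' (fun S _ => S.erase v) (fun S _ => insert v S) ?_ ?_ ?_ ?_
    · intro S hS
      simp only [Finset.mem_filter, Finset.mem_powerset, not_not] at hS ⊢
      obtain ⟨⟨hS, hI⟩, hvS⟩ := hS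
      refine ⟨fun x hx => ?_, fun a ha b hb =>
        hI a (Finset.mem_of_mem_erase ha) b (Finset.mem_of_mem_erase hb)⟩
      have hx' := Finset.mem_erase.1 hx
      simp only [Finset.mem_filter, Finset.mem_erase]
      exact ⟨⟨hx'.1, hS hx'.2⟩, hI v hvS x hx'.2⟩
    · intro S hS
      simp only [Finset.mem_filter, Finset.mem_powerset, not_not] at hS ⊢
      obtain ⟨hS, hI⟩ := hS
      have hN : ∀ x ∈ S, x ∈ s ∧ ¬ G.Adj v x := fun x hx => by
        have := hS hx
        simp only [Finset.mem_filter, Finset.mem_erase] at this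
        exact ⟨this.1.2, this.2⟩
      refine ⟨⟨Finset.insert_subset hv fun x hx => (hN x hx).1, ?_⟩, Finset.mem_insert_self _ _⟩
      intro a ha b hb
      rcases Finset.mem_insert.1 ha with rfl | ha' <;> rcases Finset.mem_insert.1 hb with rfl | hb'
      · exact G.loopless.irrefl _
      · exact (hN _ hb').2
      · exact fun h => (hN _ ha').2 h.symm
      · exact hI a ha' b hb'
    · intro S hS
      simp only [Finset.mem_filter, not_not] at hS
      exact Finset.insert_erase hS.2
    · intro S hS
      simp only [Finset.mem_filter, Finset.mem_powerset] at hS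
      refine Finset.erase_insert fun hvS => ?_
      simpa using hS.1 hvS

lemma degreeOn_erase {V : Type*} (G : SimpleGraph V) {s : Finset V} {v : V} (hv : v ∈ s) (u : V) :
    degreeOn G (s.erase v) u = if G.Adj v u then degreeOn G s u - 1 else degreeOn G s u := by
  unfold degreeOn
  rw [Finset.filter_erase]
  split_ifs with h
  · exact Finset.card_erase_of_mem (Finset.mem_filter.2 ⟨hv, h.symm⟩)
  · rw [Finset.erase_eq_of_notMem]
    exact fun h' => h (Finset.mem_filter.1 h').2.symm

lemma prod_erase_split {V : Type*} (G : SimpleGraph V) {s : Finset V} {v : V} (F : V → ℝ) :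
    ∏ u ∈ s.erase v, F u = (∏ u ∈ s.filter (G.Adj v), F u) *
      ∏ u ∈ (s.erase v).filter fun u => ¬ G.Adj v u, F u := by
  rw [← Finset.prod_filter_mul_prod_filter_not (s.erase v) (G.Adj v)]
  congr 2
  rw [Finset.filter_erase, Finset.erase_eq_of_notMem]
  simp

/-- A vertex `v` all of whose neighbours have the same degree as `v`, and whose closed
neighbourhood has no edges to the rest, lies in a clique component. -/
lemma isClusterOn_of_closed {V : Type*} (G : SimpleGraph V) {s : Finset V} {v : V} (hv : v ∈ s)
    (hdeg : ∀ u ∈ s.filter (G.Adj v), degreeOn G s u = degreeOn G s v)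
    (hclosed : ∀ w ∈ (s.erase v).filter (fun u => ¬ G.Adj v u),
      ∀ u ∈ s.filter (G.Adj v), ¬ G.Adj w u)
    (hrest : IsClusterOn G ((s.erase v).filter fun u => ¬ G.Adj v u)) : IsClusterOn G s := by
  have hclique : ∀ u ∈ s, ∀ w ∈ s, G.Adj v u → G.Adj v w → u ≠ w → G.Adj u w := by
    intro u hu w hw hvu hvw huw
    have huN : u ∈ s.filter (G.Adj v) := Finset.mem_filter.2 ⟨hu, hvu⟩
    have hsub : s.filter (G.Adj u) ⊆ (insert v (s.filter (G.Adj v))).erase u := by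
      intro x hx
      obtain ⟨hxs, hux⟩ := Finset.mem_filter.1 hx
      refine Finset.mem_erase.2 ⟨hux.ne', ?_⟩
      by_contra hx'
      simp only [Finset.mem_insert, Finset.mem_filter, not_or, not_and] at hx'
      exact hclosed x (by simp [hx'.1, hxs, hx'.2 hxs]) u huN hux.symm
    have hcard : ((insert v (s.filter (G.Adj v))).erase u).card ≤ (s.filter (G.Adj u)).card := by
      rw [Finset.card_erase_of_mem (Finset.mem_insert_of_mem huN),
        Finset.card_insert_of_notMem (by simp), Nat.add_sub_cancel]
      exact (hdeg u huN).ge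
    have hw' : w ∈ s.filter (G.Adj u) := by
      rw [Finset.eq_of_subset_of_card_le hsub hcard]
      exact Finset.mem_erase.2 ⟨huw.symm, Finset.mem_insert_of_mem (Finset.mem_filter.2 ⟨hw, hvw⟩)⟩
    exact (Finset.mem_filter.1 hw').2
  have hnbr : ∀ x ∈ s, ∀ y ∈ s, G.Adj x y → (x = v ∨ G.Adj v x) → (y = v ∨ G.Adj v y) := by
    intro x hx y hy hxy h
    rcases h with rfl | h
    · exact Or.inr hxy
    · by_contra! hy'
      exact hclosed y (by simp [hy'.1, hy'.2, hy]) x (by simp [hx, h]) hxy.symm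
  intro a ha b hb c hc hab hbc hac
  by_cases hbv : b = v ∨ G.Adj v b
  · rcases hnbr b hb a ha hab.symm hbv with rfl | hva
    · exact (hnbr b hb c hc hbc hbv).resolve_left hac.symm
    · rcases hnbr b hb c hc hbc hbv with rfl | hvc
      · exact hva.symm
      · exact hclique a ha c hc hva hvc hac
  · have hav : ¬ (a = v ∨ G.Adj v a) := fun h => hbv (hnbr a ha b hb hab h)
    have hcv : ¬ (c = v ∨ G.Adj v c) := fun h => hbv (hnbr c hc b hb hbc.symm h)
    rw [not_or] at hav hbv hcv
    exact hrest a (by simp [hav, ha]) b (by simp [hbv, hb]) c (by simp [hcv, hc]) hab hbc hac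

lemma IsClusterOn.degreeOn_eq {V : Type*} {G : SimpleGraph V} {s : Finset V} {u v : V}
    (h : IsClusterOn G s) (hu : u ∈ s) (hv : v ∈ s) (huv : G.Adj v u) :
    degreeOn G s u = degreeOn G s v := by
  have aux : ∀ x ∈ s, ∀ y ∈ s, G.Adj x y → degreeOn G s x ≤ degreeOn G s y := by
    intro x hx y hy hxy
    unfold degreeOn
    have h1 : y ∈ s.filter (G.Adj x) := Finset.mem_filter.2 ⟨hy, hxy⟩
    have h2 : x ∈ s.filter (G.Adj y) := Finset.mem_filter.2 ⟨hx, hxy.symm⟩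
    have h3 : (s.filter (G.Adj x)).erase y ⊆ (s.filter (G.Adj y)).erase x := by
      intro z hz
      simp only [Finset.mem_erase, Finset.mem_filter] at hz ⊢
      exact ⟨hz.2.2.ne', hz.2.1, h y hy x hx z hz.2.1 hxy.symm hz.2.2 hz.1.symm⟩
    have h4 := Finset.card_le_card h3
    rw [Finset.card_erase_of_mem h1, Finset.card_erase_of_mem h2] at h4
    have := Finset.card_pos.2 ⟨_, h1⟩
    have := Finset.card_pos.2 ⟨_, h2⟩
    omega
  exact le_antisymm (aux u hu v hv huv.symm) (aux v hv u hu huv)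

lemma weight_strictAnti : StrictAnti weight := fun a b h => by
  rw [weight_eq_exp, weight_eq_exp]
  exact Real.exp_lt_exp.2 (logWeight_strictAnti h)

/-- The bound and its equality case for the subgraph induced on `s`. -/
theorem prod_weight_le_indepCountOn {V : Type*} (G : SimpleGraph V) (s : Finset V) :
    ∏ v ∈ s, weight (degreeOn G s v) ≤ indepCountOn G s ∧
      (∏ v ∈ s, weight (degreeOn G s v) = indepCountOn G s ↔ IsClusterOn G s) := by
  induction s using Finset.strongInduction with
  | H s ih =>
  rcases s.eq_empty_or_nonempty with rfl | hs
  · simp [indepCountOn, IsClusterOn, Finset.filter_singleton]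
  obtain ⟨v, hv, hmax⟩ := Finset.exists_max_image s (degreeOn G s) hs
  set N := s.filter (G.Adj v) with hN
  set t := (s.erase v).filter (fun u => ¬ G.Adj v u) with ht
  have hsub : s.erase v ⊂ s := Finset.erase_ssubset hv
  have hts : t ⊂ s := (Finset.filter_subset _ _).trans_ssubset hsub
  obtain ⟨ih1, ih1'⟩ := ih _ hsub
  obtain ⟨ih2, ih2'⟩ := ih _ hts
  have hsplit : (indepCountOn G s : ℝ) = indepCountOn G (s.erase v) + indepCountOn G t := by
    exact_mod_cast indepCountOn_split G hv
  obtain ⟨key, key'⟩ := weight_mul_prod_le N (degreeOn G s)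
    (fun u hu => Finset.card_pos.2
      ⟨v, Finset.mem_filter.2 ⟨hv, (Finset.mem_filter.1 hu).2.symm⟩⟩)
    (fun u hu => hmax u (Finset.mem_filter.1 hu).1)
  set R := ∏ u ∈ t, weight (degreeOn G s u) with hR
  have hRpos : 0 < R := Finset.prod_pos fun u _ => weight_pos _
  have hP : ∏ u ∈ s, weight (degreeOn G s u) =
      (weight N.card * ∏ u ∈ N, weight (degreeOn G s u)) * R := by
    rw [← Finset.mul_prod_erase s _ hv, prod_erase_split G, mul_assoc]
    rfl
  have hP1 : ∏ u ∈ s.erase v, weight (degreeOn G (s.erase v) u) =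
      (∏ u ∈ N, weight (degreeOn G s u - 1)) * R := by
    rw [prod_erase_split G]
    congr 1
    · refine Finset.prod_congr rfl fun u hu => ?_
      rw [degreeOn_erase G hv, if_pos (Finset.mem_filter.1 hu).2]
    · refine Finset.prod_congr rfl fun u hu => ?_
      rw [degreeOn_erase G hv, if_neg (Finset.mem_filter.1 hu).2]
  have hterm : ∀ u ∈ t, weight (degreeOn G s u) ≤ weight (degreeOn G t u) := fun u _ =>
    weight_strictAnti.antitone (degreeOn_mono G hts.1 u)
  have hP2 : R ≤ ∏ u ∈ t, weight (degreeOn G t u) :=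
    Finset.prod_le_prod (fun u _ => (weight_pos _).le) hterm
  have hkeyR := mul_le_mul_of_nonneg_right key hRpos.le
  rw [hP, hsplit]
  rw [hP1] at ih1 ih1'
  refine ⟨by linarith, fun heq => ?_, fun hcl => ?_⟩
  · have e1 : weight N.card * ∏ u ∈ N, weight (degreeOn G s u) =
        ∏ u ∈ N, weight (degreeOn G s u - 1) + 1 :=
      mul_right_cancel₀ hRpos.ne' (by linarith)
    have e2 : R = ∏ u ∈ t, weight (degreeOn G t u) := by linarith
    have e3 : ∏ u ∈ t, weight (degreeOn G t u) = indepCountOn G t := by linarith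
    refine isClusterOn_of_closed G hv (key'.1 e1) (fun w hw u hu hwu => ?_) (ih2'.1 e3)
    have hlt : degreeOn G t w < degreeOn G s w := by
      refine Finset.card_lt_card ((Finset.ssubset_iff_of_subset
        (Finset.filter_subset_filter _ hts.1)).2 ⟨u, ?_, ?_⟩)
      · exact Finset.mem_filter.2 ⟨(Finset.mem_filter.1 hu).1, hwu⟩
      · intro h
        exact (Finset.mem_filter.1 (Finset.mem_filter.1 h).1).2 (Finset.mem_filter.1 hu).2
    exact e2.not_lt (Finset.prod_lt_prod (fun u _ => weight_pos _) hterm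
      ⟨w, hw, weight_strictAnti hlt⟩)
  · have e1 := key'.2 fun u hu =>
      hcl.degreeOn_eq (Finset.mem_filter.1 hu).1 hv (Finset.mem_filter.1 hu).2
    have e2 : R = ∏ u ∈ t, weight (degreeOn G t u) := by
      refine Finset.prod_congr rfl fun w hw => ?_
      unfold degreeOn
      congr 2
      ext x
      simp only [ht, Finset.mem_filter, Finset.mem_erase] at hw ⊢
      refine ⟨fun hx => ⟨⟨⟨?_, hx.1⟩, fun hvx => ?_⟩, hx.2⟩, fun hx => ⟨hx.1.1.2, hx.2⟩⟩
      · rintro rfl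
        exact hw.2 hx.2.symm
      · exact hw.2 (hcl v hv x hx.1 w hw.1.2 hvx hx.2.symm hw.1.1.symm)
    have e3 := ih1'.2 (hcl.mono hsub.1)
    have e4 := ih2'.2 (hcl.mono hts.1)
    rw [e1, ← e3, ← e4, ← e2]
    ring

lemma isClusterOn_univ_iff {V : Type*} [Fintype V] (G : SimpleGraph V) :
    IsClusterOn G Finset.univ ↔ IsDisjUnionOfCliques G := by
  constructor
  · rintro h u v ⟨p⟩
    induction p with
    | nil => exact fun hne => absurd rfl hne
    | @cons a b c hab _ ih =>
      intro hne
      by_cases hbc : b = c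
      · exact hbc ▸ hab
      · exact h a (Finset.mem_univ _) b (Finset.mem_univ _) c (Finset.mem_univ _) hab (ih hbc) hne
  · intro h a _ b _ c _ hab hbc hne
    exact h a c (hab.reachable.trans hbc.reachable) hne

/-- **Sah–Sawhney–Stoner–Zhao (lower bound).** For every graph `G`,
`i(G) ≥ ∏_{v ∈ V(G)} (d_v + 2)^{1/(d_v + 1)}`, with equality iff `G` is a disjoint
union of cliques. -/
theorem independent_sets_lower_bound {V : Type*} [Fintype V] (G : SimpleGraph V) :
    (numIndepSets G : ℝ) ≥
        ∏ v : V, ((G.degree v : ℝ) + 2) ^ ((1:ℝ) / ((G.degree v : ℝ) + 1)) ∧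
      ((numIndepSets G : ℝ) =
          ∏ v : V, ((G.degree v : ℝ) + 2) ^ ((1:ℝ) / ((G.degree v : ℝ) + 1)) ↔
        IsDisjUnionOfCliques G) := by
  have hcount : indepCountOn G Finset.univ = numIndepSets G := by
    rw [indepCountOn, numIndepSets, Finset.powerset_univ]
    congr!
  have hdeg : ∀ v, degreeOn G Finset.univ v = G.degree v := fun v => by
    rw [degreeOn, ← SimpleGraph.card_neighborFinset_eq_degree, SimpleGraph.neighborFinset_eq_filter]
  have h := prod_weight_le_indepCountOn G Finset.univ
  rw [isClusterOn_univ_iff, hcount] at h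
  simp only [hdeg, weight] at h
  exact ⟨h.1, eq_comm.trans h.2⟩
end

section
/- Let G be a finite simple graph, let d_v denote the degree of vertex v in G, and let λ > 0 be a real number. Then the independence polynomial satisfies P_G(λ) ≥ ∏_{v ∈ V(G)} ((d_v + 1)λ + 1)^{1/(d_v + 1)}, where the product is over all vertices of G. Moreover, equality holds if and only if G is a disjoint union of cliques (i.e., every connected component of G is a complete graph). -/
open Finset
open scoped Classical

/-- The independence polynomial (hard-core partition function)
`P_G(x) = ∑_{I ∈ I(G)} x^{|I|}` of a finite simple graph `G`. -/
noncomputable def indepPoly {V : Type*} [Fintype V] (G : SimpleGraph V) (x : ℝ) : ℝ :=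
  ∑ S ∈ Finset.univ.filter (fun S : Finset V => ∀ u ∈ S, ∀ v ∈ S, ¬ G.Adj u v), x ^ S.card

/-- The logarithm of the `x`-th root of `1 + x * lam`. -/
noncomputable def logRoot (lam x : ℝ) : ℝ := Real.log (1 + x * lam) / x

lemma hasDerivAt_logRoot {lam x : ℝ} (hlam : 0 < lam) (hx : 0 < x) :
    HasDerivAt (logRoot lam)
      (-(((1 + x * lam) * Real.log (1 + x * lam) - x * lam) / x ^ 2) / (1 + x * lam)) x := by
  have hpos : 0 < 1 + x * lam := by positivity
  have h1 : HasDerivAt (fun y : ℝ => 1 + y * lam) lam x := by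
    simpa using ((hasDerivAt_id x).mul_const lam).const_add 1
  have h2 := (h1.log hpos.ne').div (hasDerivAt_id x) hx.ne'
  refine h2.congr_deriv ?_
  simp only [id]
  field_simp
  ring

lemma lt_one_add_mul_log {y : ℝ} (hy : 0 < y) : y < (1 + y) * Real.log (1 + y) := by
  have h := Real.le_log_one_add_of_nonneg hy.le
  have h2 : y < (1 + y) * (2 * y / (y + 2)) := by
    rw [mul_div_assoc', lt_div_iff₀ (by positivity)]
    nlinarith [mul_pos hy hy]
  exact h2.trans_le (mul_le_mul_of_nonneg_left h (by positivity))

lemma strictAntiOn_logRoot {lam : ℝ} (hlam : 0 < lam) :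
    StrictAntiOn (logRoot lam) (Set.Ioi 0) := by
  refine strictAntiOn_of_deriv_neg (convex_Ioi 0)
    (fun x hx => (hasDerivAt_logRoot hlam hx).continuousAt.continuousWithinAt) fun x hx => ?_
  rw [interior_Ioi] at hx
  have hx : 0 < x := hx
  rw [(hasDerivAt_logRoot hlam hx).deriv, neg_div, neg_lt_zero]
  have := lt_one_add_mul_log (mul_pos hx hlam)
  have h3 : 0 < (1 + x * lam) * Real.log (1 + x * lam) - x * lam := by linarith
  positivity

lemma antitoneOn_entropy_div_sq {lam : ℝ} (hlam : 0 < lam) :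
    AntitoneOn (fun x : ℝ => ((1 + x * lam) * Real.log (1 + x * lam) - x * lam) / x ^ 2)
      (Set.Ioi 0) := by
  have hder : ∀ x : ℝ, 0 < x → HasDerivAt
      (fun x : ℝ => ((1 + x * lam) * Real.log (1 + x * lam) - x * lam) / x ^ 2)
      ((2 * (x * lam) - (x * lam + 2) * Real.log (1 + x * lam)) / x ^ 3) x := by
    intro x hx
    have hpos : 0 < 1 + x * lam := by positivity
    have h0 : HasDerivAt (fun y : ℝ => y * lam) lam x := by
      simpa using (hasDerivAt_id x).mul_const lam
    have h1 : HasDerivAt (fun y : ℝ => 1 + y * lam) lam x := h0.const_add 1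
    have h2 := ((h1.mul (h1.log hpos.ne')).sub h0).div (hasDerivAt_pow 2 x) (by positivity)
    refine h2.congr_deriv ?_
    simp only [Pi.mul_apply, Pi.sub_apply]
    field_simp
    ring
  refine antitoneOn_of_deriv_nonpos (convex_Ioi 0)
    (fun x hx => (hder x hx).continuousAt.continuousWithinAt)
    (fun x hx => ?_) fun x hx => ?_
  · rw [interior_Ioi] at hx
    exact (hder x hx).differentiableAt.differentiableWithinAt
  · rw [interior_Ioi] at hx
    have hx : 0 < x := hx
    rw [(hder x hx).deriv]
    have h := Real.le_log_one_add_of_nonneg (mul_pos hx hlam).le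
    rw [div_le_iff₀ (by positivity)] at h
    apply div_nonpos_of_nonpos_of_nonneg _ (by positivity)
    linarith

lemma strictAntiOn_mul_logRoot_sub {lam D : ℝ} (hlam : 0 < lam) :
    StrictAntiOn (fun x => (1 + D * lam) / (1 + (D + 1) * lam) * logRoot lam x -
      logRoot lam (x + 1)) (Set.Ioc 0 D) := by
  set c := (1 + D * lam) / (1 + (D + 1) * lam)
  have hder : ∀ x : ℝ, 0 < x → HasDerivAt (fun x => c * logRoot lam x - logRoot lam (x + 1))
      (c * (-(((1 + x * lam) * Real.log (1 + x * lam) - x * lam) / x ^ 2) / (1 + x * lam)) -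
        -(((1 + (x + 1) * lam) * Real.log (1 + (x + 1) * lam) - (x + 1) * lam) / (x + 1) ^ 2) /
          (1 + (x + 1) * lam)) x := by
    intro x hx
    exact ((hasDerivAt_logRoot hlam hx).const_mul c).sub
      ((hasDerivAt_logRoot hlam (by linarith : 0 < x + 1)).comp_add_const x 1)
  refine strictAntiOn_of_deriv_neg (convex_Ioc 0 D)
    (fun x hx => (hder x hx.1).continuousAt.continuousWithinAt) fun x hx => ?_
  rw [interior_Ioc] at hx
  obtain ⟨hx, hxD⟩ := hx
  rw [(hder x hx).deriv]
  have hmono := antitoneOn_entropy_div_sq hlam (Set.mem_Ioi.2 hx)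
    (Set.mem_Ioi.2 (by linarith : 0 < x + 1)) (by linarith)
  have hpos : 0 < ((1 + x * lam) * Real.log (1 + x * lam) - x * lam) / x ^ 2 := by
    have := lt_one_add_mul_log (mul_pos hx hlam)
    exact div_pos (by linarith) (by positivity)
  simp only at hmono
  set p := ((1 + x * lam) * Real.log (1 + x * lam) - x * lam) / x ^ 2
  set q := ((1 + (x + 1) * lam) * Real.log (1 + (x + 1) * lam) - (x + 1) * lam) / (x + 1) ^ 2
  have hD : 0 < D := hx.trans hxD
  have h1 : 0 < 1 + x * lam := by positivity
  have h2 : 0 < 1 + (x + 1) * lam := by positivity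
  have h3 : 0 < 1 + (D + 1) * lam := by positivity
  have hc : (1 + x * lam) / (1 + (x + 1) * lam) < c := by
    rw [div_lt_div_iff₀ h2 h3]
    nlinarith [mul_pos (sub_pos.2 hxD) (mul_pos hlam hlam), mul_pos (sub_pos.2 hxD) hlam]
  have h4 : q / (1 + (x + 1) * lam) ≤ p / (1 + (x + 1) * lam) := by gcongr
  have h5 : p / (1 + (x + 1) * lam) < c * (p / (1 + x * lam)) := by
    calc p / (1 + (x + 1) * lam)
        = (1 + x * lam) / (1 + (x + 1) * lam) * (p / (1 + x * lam)) := by field_simp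
      _ < c * (p / (1 + x * lam)) := by gcongr
  rw [neg_div, neg_div]
  linarith

/-- The factor contributed by a vertex of degree `n`: the `(n + 1)`-st root of the independence
polynomial of the complete graph on `n + 1` vertices. -/
noncomputable def cliqueRoot (lam : ℝ) (n : ℕ) : ℝ :=
  (((n : ℝ) + 1) * lam + 1) ^ ((1 : ℝ) / ((n : ℝ) + 1))

lemma cliqueRoot_eq_exp {lam : ℝ} (hlam : 0 < lam) (n : ℕ) :
    cliqueRoot lam n = Real.exp (logRoot lam (n + 1)) := by
  rw [cliqueRoot, logRoot, Real.rpow_def_of_pos (by positivity), add_comm _ (1 : ℝ)]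
  ring_nf

lemma cliqueRoot_pos {lam : ℝ} (hlam : 0 < lam) (n : ℕ) : 0 < cliqueRoot lam n := by
  rw [cliqueRoot_eq_exp hlam]
  exact Real.exp_pos _

lemma strictAnti_cliqueRoot {lam : ℝ} (hlam : 0 < lam) : StrictAnti (cliqueRoot lam) := by
  intro m n hmn
  rw [cliqueRoot_eq_exp hlam, cliqueRoot_eq_exp hlam, Real.exp_lt_exp]
  have : (m : ℝ) < n := by exact_mod_cast hmn
  exact strictAntiOn_logRoot hlam (Set.mem_Ioi.2 (by positivity)) (Set.mem_Ioi.2 (by positivity))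
    (by linarith)

lemma exp_mul_logRoot {lam x : ℝ} (hlam : 0 < lam) (hx : 0 ≤ x) :
    Real.exp (x * logRoot lam x) = 1 + x * lam := by
  rcases hx.eq_or_lt with rfl | hx
  · simp
  · rw [logRoot, mul_div_cancel₀ _ hx.ne', Real.exp_log (by positivity)]

lemma prod_cliqueRoot_sub_one {ι : Type*} {lam : ℝ} (hlam : 0 < lam) {N : Finset ι} {d : ι → ℕ}
    (hd : ∀ u ∈ N, 1 ≤ d u) :
    ∏ u ∈ N, cliqueRoot lam (d u - 1) = Real.exp (∑ u ∈ N, logRoot lam (d u)) := by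
  rw [Real.exp_sum]
  refine Finset.prod_congr rfl fun u hu => ?_
  rw [cliqueRoot_eq_exp hlam, Nat.cast_sub (hd u hu)]
  simp

lemma cliqueRoot_mul_prod_of_eq {ι : Type*} {lam : ℝ} (hlam : 0 < lam) {N : Finset ι} {d : ι → ℕ}
    (hd : ∀ u ∈ N, d u = #N) :
    cliqueRoot lam #N * ∏ u ∈ N, cliqueRoot lam (d u) =
      ∏ u ∈ N, cliqueRoot lam (d u - 1) + lam := by
  have hd1 : ∀ u ∈ N, 1 ≤ d u := fun u hu => hd u hu ▸ Finset.card_pos.2 ⟨u, hu⟩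
  rw [prod_cliqueRoot_sub_one hlam hd1, Finset.prod_congr rfl fun u hu => by rw [hd u hu],
    Finset.sum_congr rfl fun u hu => by rw [hd u hu]]
  simp only [Finset.prod_const, Finset.sum_const, nsmul_eq_mul]
  rw [exp_mul_logRoot hlam (by positivity), ← pow_succ', cliqueRoot_eq_exp hlam, ← Real.exp_nat_mul]
  push_cast
  rw [exp_mul_logRoot hlam (by positivity)]
  ring

lemma cliqueRoot_mul_prod_le {ι : Type*} {lam : ℝ} (hlam : 0 < lam) {N : Finset ι} {d : ι → ℕ}
    (hd : ∀ u ∈ N, 1 ≤ d u) (hdN : ∀ u ∈ N, d u ≤ #N) :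
    cliqueRoot lam #N * ∏ u ∈ N, cliqueRoot lam (d u) ≤
        ∏ u ∈ N, cliqueRoot lam (d u - 1) + lam ∧
      (cliqueRoot lam #N * ∏ u ∈ N, cliqueRoot lam (d u) =
        ∏ u ∈ N, cliqueRoot lam (d u - 1) + lam → ∀ u ∈ N, d u = #N) := by
  set D : ℝ := (#N : ℝ) with hD
  have hD0 : 0 ≤ D := by positivity
  set c := (1 + D * lam) / (1 + (D + 1) * lam) with hc
  have hM : 0 < 1 + (D + 1) * lam := by positivity
  have hc0 : 0 ≤ c := by positivity
  have hc1 : 1 - c = lam / (1 + (D + 1) * lam) := by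
    rw [hc]; field_simp; ring
  have hmem : ∀ u ∈ N, (d u : ℝ) ∈ Set.Ioc 0 D ∧ D ∈ Set.Ioc 0 D := by
    intro u hu
    have h1 : (1 : ℝ) ≤ d u := by exact_mod_cast hd u hu
    have h2 : (d u : ℝ) ≤ D := Nat.cast_le.2 (hdN u hu)
    exact ⟨⟨by linarith, h2⟩, ⟨by linarith, le_rfl⟩⟩
  have hanti := strictAntiOn_mul_logRoot_sub (D := D) hlam
  have hterm : ∀ u ∈ N, logRoot lam (d u + 1) - logRoot lam (D + 1) ≤
      c * (logRoot lam (d u) - logRoot lam D) := by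
    intro u hu
    have := hanti.antitoneOn (hmem u hu).1 (hmem u hu).2 (hmem u hu).1.2
    linarith
  set A := ∑ u ∈ N, (logRoot lam (d u) - logRoot lam D) with hA
  set B := ∑ u ∈ N, (logRoot lam (d u + 1) - logRoot lam (D + 1)) with hB
  have hBA : B ≤ c * A := by
    rw [hA, Finset.mul_sum]
    exact Finset.sum_le_sum hterm
  have hleft : cliqueRoot lam #N * ∏ u ∈ N, cliqueRoot lam (d u) =
      (1 + (D + 1) * lam) * Real.exp B := by
    rw [← exp_mul_logRoot hlam (by positivity : 0 ≤ D + 1), cliqueRoot_eq_exp hlam,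
      Finset.prod_congr rfl fun u _ => cliqueRoot_eq_exp hlam (d u), ← Real.exp_sum,
      ← Real.exp_add, ← Real.exp_add, hB, Finset.sum_sub_distrib]
    simp only [Finset.sum_const, nsmul_eq_mul, ← hD]
    ring_nf
  have hright : ∏ u ∈ N, cliqueRoot lam (d u - 1) + lam =
      (1 + (D + 1) * lam) * (c * Real.exp A + (1 - c)) := by
    have h1 : ∏ u ∈ N, cliqueRoot lam (d u - 1) = (1 + D * lam) * Real.exp A := by
      rw [prod_cliqueRoot_sub_one hlam hd, ← exp_mul_logRoot hlam hD0, ← Real.exp_add, hA,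
        Finset.sum_sub_distrib]
      simp only [Finset.sum_const, nsmul_eq_mul, ← hD]
      ring_nf
    rw [h1, hc1, hc]
    field_simp
  have hconv : Real.exp (c * A) ≤ c * Real.exp A + (1 - c) := by
    have := convexOn_exp.2 (Set.mem_univ A) (Set.mem_univ 0) hc0
      (by rw [hc1]; positivity : 0 ≤ 1 - c) (by ring)
    simpa using this
  rw [hleft, hright]
  constructor
  · gcongr
    exact (Real.exp_le_exp.2 hBA).trans hconv
  · intro heq
    by_contra! hne
    obtain ⟨u, hu, hune⟩ := hne
    have hlt : B < c * A := by
      rw [hA, Finset.mul_sum]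
      refine Finset.sum_lt_sum hterm ⟨u, hu, ?_⟩
      have h2 : (d u : ℝ) < D := Nat.cast_lt.2 (lt_of_le_of_ne (hdN u hu) hune)
      have := hanti (hmem u hu).1 (hmem u hu).2 h2
      simp only at this
      linarith
    have := mul_left_cancel₀ hM.ne' heq
    linarith [Real.exp_lt_exp.2 hlt]

section Induction

variable {V : Type*} (G : SimpleGraph V)

/-- The independence polynomial of the subgraph of `G` induced on `S`. -/
noncomputable def indepPolyOn (x : ℝ) (S : Finset V) : ℝ :=
  ∑ T ∈ S.powerset with ∀ u ∈ T, ∀ v ∈ T, ¬ G.Adj u v, x ^ #T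

/-- The neighbours of `v` inside `S`. -/
noncomputable def nbrsOn (S : Finset V) (v : V) : Finset V := {u ∈ S | G.Adj v u}

/-- The vertices of `S` outside the closed neighbourhood of `v`. -/
noncomputable def farOn (S : Finset V) (v : V) : Finset V := {u ∈ S | u ≠ v ∧ ¬ G.Adj v u}

variable {G}

lemma mem_nbrsOn {S : Finset V} {u v : V} : u ∈ nbrsOn G S v ↔ u ∈ S ∧ G.Adj v u := by
  simp [nbrsOn]

lemma mem_farOn {S : Finset V} {u v : V} :
    u ∈ farOn G S v ↔ u ∈ S ∧ u ≠ v ∧ ¬ G.Adj v u := by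
  simp [farOn]

lemma indepPolyOn_eq_add (x : ℝ) {S : Finset V} {v : V} (hv : v ∈ S) :
    indepPolyOn G x S = indepPolyOn G x (S.erase v) + x * indepPolyOn G x (farOn G S v) := by
  have hsplit := Finset.sum_filter_add_sum_filter_not
    {T ∈ S.powerset | ∀ u ∈ T, ∀ w ∈ T, ¬ G.Adj u w} (fun T => v ∉ T) (fun T => x ^ #T)
  rw [indepPolyOn, ← hsplit]
  congr 1
  · rw [indepPolyOn]
    refine Finset.sum_congr ?_ fun _ _ => rfl
    ext T
    simp only [Finset.mem_filter, Finset.mem_powerset, Finset.subset_erase]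
    tauto
  · rw [indepPolyOn, Finset.mul_sum]
    refine Finset.sum_bij' (fun T _ => T.erase v) (fun T _ => insert v T) ?_ ?_ ?_ ?_ ?_
    · intro T hT
      simp only [Finset.mem_filter, Finset.mem_powerset, not_not] at hT ⊢
      obtain ⟨⟨hTS, hT⟩, hvT⟩ := hT
      refine ⟨fun u hu => ?_, fun u hu w hw =>
        hT u (Finset.mem_of_mem_erase hu) w (Finset.mem_of_mem_erase hw)⟩
      obtain ⟨h1, h2⟩ := Finset.mem_erase.1 hu
      exact mem_farOn.2 ⟨hTS h2, h1, hT v hvT u h2⟩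
    · intro T hT
      simp only [Finset.mem_filter, Finset.mem_powerset, not_not] at hT ⊢
      obtain ⟨hTS, hT⟩ := hT
      have hfar := fun u hu => (mem_farOn.1 (hTS hu : u ∈ farOn G S v))
      refine ⟨⟨Finset.insert_subset hv fun u hu => (hfar u hu).1, ?_⟩, Finset.mem_insert_self _ _⟩
      intro u hu w hw
      rcases Finset.mem_insert.1 hu with rfl | huT <;>
        rcases Finset.mem_insert.1 hw with rfl | hwT
      · exact G.irrefl
      · exact (hfar w hwT).2.2
      · exact fun h => (hfar u huT).2.2 h.symm
      · exact hT u huT w hwT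
    · intro T hT
      simp only [Finset.mem_filter, not_not] at hT
      exact Finset.insert_erase hT.2
    · intro T hT
      simp only [Finset.mem_filter, Finset.mem_powerset] at hT
      exact Finset.erase_insert fun h => (mem_farOn.1 (hT.1 h)).2.1 rfl
    · intro T hT
      simp only [Finset.mem_filter, not_not] at hT
      rw [← pow_succ', Finset.card_erase_add_one hT.2]

lemma erase_eq_nbrsOn_union_farOn (S : Finset V) (v : V) :
    S.erase v = nbrsOn G S v ∪ farOn G S v := by
  ext u
  simp only [Finset.mem_erase, Finset.mem_union, mem_nbrsOn, mem_farOn]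
  by_cases h : u = v
  · subst h; simp
  · tauto

lemma disjoint_nbrsOn_farOn (S : Finset V) (v : V) :
    Disjoint (nbrsOn G S v) (farOn G S v) := by
  rw [Finset.disjoint_left]
  intro u h1 h2
  exact (mem_farOn.1 h2).2.2 (mem_nbrsOn.1 h1).2

lemma prod_erase_eq (S : Finset V) (v : V) (f : V → ℝ) :
    ∏ u ∈ S.erase v, f u = (∏ u ∈ nbrsOn G S v, f u) * ∏ u ∈ farOn G S v, f u := by
  rw [erase_eq_nbrsOn_union_farOn (G := G), Finset.prod_union (disjoint_nbrsOn_farOn S v)]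

lemma nbrsOn_erase (S : Finset V) (u v : V) :
    nbrsOn G (S.erase v) u = (nbrsOn G S u).erase v := by
  ext w
  simp only [mem_nbrsOn, Finset.mem_erase]
  tauto

lemma nbrsOn_farOn_subset (S : Finset V) (u v : V) :
    nbrsOn G (farOn G S v) u ⊆ nbrsOn G S u := fun _ hw =>
  mem_nbrsOn.2 ⟨(mem_farOn.1 (mem_nbrsOn.1 hw).1).1, (mem_nbrsOn.1 hw).2⟩

variable (G) in
/-- Adjacency is transitive on `S`, so the subgraph induced on `S` is a disjoint union of
cliques. -/
def IsCliqueUnionOn (S : Finset V) : Prop :=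
  ∀ u ∈ S, ∀ v ∈ S, ∀ w ∈ S, G.Adj u v → G.Adj v w → u ≠ w → G.Adj u w

lemma IsCliqueUnionOn.mono {S T : Finset V} (h : IsCliqueUnionOn G S) (hTS : T ⊆ S) :
    IsCliqueUnionOn G T := fun u hu v hv w hw => h u (hTS hu) v (hTS hv) w (hTS hw)

lemma IsCliqueUnionOn.card_nbrsOn_eq {S : Finset V} (h : IsCliqueUnionOn G S) {u v : V}
    (hv : v ∈ S) (hu : u ∈ nbrsOn G S v) : #(nbrsOn G S u) = #(nbrsOn G S v) := by
  obtain ⟨huS, hvu⟩ := mem_nbrsOn.1 hu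
  have heq : nbrsOn G S u = (insert v (nbrsOn G S v)).erase u := by
    ext w
    simp only [Finset.mem_erase, Finset.mem_insert, mem_nbrsOn]
    constructor
    · rintro ⟨hw, huw⟩
      refine ⟨huw.ne', ?_⟩
      by_cases hwv : w = v
      · exact Or.inl hwv
      · exact Or.inr ⟨hw, h v hv u huS w hw hvu huw (Ne.symm hwv)⟩
    · rintro ⟨hwu, rfl | ⟨hw, hvw⟩⟩
      · exact ⟨hv, hvu.symm⟩
      · exact ⟨hw, h u huS v hv w hw hvu.symm hvw (Ne.symm hwu)⟩
  rw [heq, Finset.card_erase_of_mem (Finset.mem_insert_of_mem hu), Finset.card_insert_of_notMem]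
  · simp
  · simp [mem_nbrsOn]

lemma IsCliqueUnionOn.nbrsOn_farOn_eq {S : Finset V} (h : IsCliqueUnionOn G S) {u v : V}
    (hv : v ∈ S) (hu : u ∈ farOn G S v) : nbrsOn G (farOn G S v) u = nbrsOn G S u := by
  refine (nbrsOn_farOn_subset S u v).antisymm fun w hw => ?_
  obtain ⟨huS, huv, hvu⟩ := mem_farOn.1 hu
  obtain ⟨hwS, huw⟩ := mem_nbrsOn.1 hw
  refine mem_nbrsOn.2 ⟨mem_farOn.2 ⟨hwS, ?_, ?_⟩, huw⟩
  · rintro rfl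
    exact hvu huw.symm
  · intro hvw
    exact hvu (h v hv w hwS u huS hvw huw.symm huv.symm)

lemma isCliqueUnionOn_of_farOn {S : Finset V} {v : V}
    (hR : IsCliqueUnionOn G (farOn G S v))
    (hclosed : ∀ u ∈ farOn G S v, nbrsOn G (farOn G S v) u = nbrsOn G S u)
    (hdeg : ∀ u ∈ nbrsOn G S v, #(nbrsOn G S u) = #(nbrsOn G S v)) :
    IsCliqueUnionOn G S := by
  have hfar : ∀ u ∈ farOn G S v, ∀ w ∈ S, G.Adj u w → w ∈ farOn G S v := by
    intro u hu w hw huw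
    have : w ∈ nbrsOn G (farOn G S v) u := by
      rw [hclosed u hu]
      exact mem_nbrsOn.2 ⟨hw, huw⟩
    exact (mem_nbrsOn.1 this).1
  have hcases : ∀ u ∈ S, u ∉ farOn G S v → u = v ∨ G.Adj v u := by
    intro u hu hn
    rw [mem_farOn] at hn
    tauto
  have hclique : ∀ u ∈ S, ∀ w ∈ S, u ∉ farOn G S v → w ∉ farOn G S v → u ≠ w → G.Adj u w := by
    intro u hu w hw hun hwn huw
    rcases hcases u hu hun with rfl | hvu
    · exact (hcases w hw hwn).resolve_left huw.symm
    · have huN : u ∈ nbrsOn G S v := mem_nbrsOn.2 ⟨hu, hvu⟩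
      have hsub : nbrsOn G S u ⊆ (insert v (nbrsOn G S v)).erase u := by
        intro t ht
        obtain ⟨htS, hut⟩ := mem_nbrsOn.1 ht
        refine Finset.mem_erase.2 ⟨hut.ne', Finset.mem_insert.2 ?_⟩
        have htn : t ∉ farOn G S v := fun h => hun (hfar t h u hu hut.symm)
        exact (hcases t htS htn).imp_right fun h => mem_nbrsOn.2 ⟨htS, h⟩
      have heq := Finset.eq_of_subset_of_card_le hsub (by
        rw [Finset.card_erase_of_mem (Finset.mem_insert_of_mem huN), hdeg u huN]
        have := Finset.card_insert_le v (nbrsOn G S v)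
        omega)
      have hwm : w ∈ nbrsOn G S u := by
        rw [heq]
        refine Finset.mem_erase.2 ⟨huw.symm, Finset.mem_insert.2 ?_⟩
        exact (hcases w hw hwn).imp_right fun h => mem_nbrsOn.2 ⟨hw, h⟩
      exact (mem_nbrsOn.1 hwm).2
  intro u hu t ht w hw hut htw huw
  by_cases htR : t ∈ farOn G S v
  · exact hR u (hfar t htR u hu hut.symm) t htR w (hfar t htR w hw htw) hut htw huw
  · exact hclique u hu w hw (fun h => htR (hfar u h t ht hut))
      (fun h => htR (hfar w h t ht htw.symm)) huw

theorem indepPolyOn_lower_bound {lam : ℝ} (hlam : 0 < lam) (S : Finset V) :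
    ∏ v ∈ S, cliqueRoot lam #(nbrsOn G S v) ≤ indepPolyOn G lam S ∧
      (indepPolyOn G lam S = ∏ v ∈ S, cliqueRoot lam #(nbrsOn G S v) ↔ IsCliqueUnionOn G S) := by
  induction S using Finset.strongInduction with
  | H S ih =>
  rcases S.eq_empty_or_nonempty with rfl | hne
  · simp [indepPolyOn, IsCliqueUnionOn, Finset.filter_singleton]
  obtain ⟨v, hv, hmax⟩ := S.exists_max_image (fun v => #(nbrsOn G S v)) hne
  set N := nbrsOn G S v
  set R := farOn G S v
  set d : V → ℕ := fun u => #(nbrsOn G S u)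
  have hRS : R ⊂ S := by
    refine ⟨Finset.filter_subset _ _, fun h => (mem_farOn.1 (h hv)).2.1 rfl⟩
  obtain ⟨ihE, ihE_eq⟩ := ih _ (Finset.erase_ssubset hv)
  obtain ⟨ihR, ihR_eq⟩ := ih _ hRS
  have hNmem : ∀ u ∈ N, u ∈ S ∧ G.Adj v u := fun u hu => mem_nbrsOn.1 hu
  have hprodE : ∏ u ∈ S.erase v, cliqueRoot lam #(nbrsOn G (S.erase v) u) =
      (∏ u ∈ N, cliqueRoot lam (d u - 1)) * ∏ u ∈ R, cliqueRoot lam (d u) := by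
    rw [prod_erase_eq (G := G)]
    congr 1
    · refine Finset.prod_congr rfl fun u hu => ?_
      rw [nbrsOn_erase, Finset.card_erase_of_mem (mem_nbrsOn.2 ⟨hv, (hNmem u hu).2.symm⟩)]
    · refine Finset.prod_congr rfl fun u hu => ?_
      rw [nbrsOn_erase, Finset.erase_eq_of_notMem]
      exact fun h => (mem_farOn.1 hu).2.2 (mem_nbrsOn.1 h).2.symm
  have hprodS : ∏ u ∈ S, cliqueRoot lam (d u) =
      cliqueRoot lam #N * (∏ u ∈ N, cliqueRoot lam (d u)) * ∏ u ∈ R, cliqueRoot lam (d u) := by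
    rw [← Finset.mul_prod_erase _ _ hv, prod_erase_eq (G := G), mul_assoc]
  obtain ⟨hloc, hloc_eq⟩ := cliqueRoot_mul_prod_le (N := N) (d := d) hlam
    (fun u hu => Finset.card_pos.2 ⟨v, mem_nbrsOn.2 ⟨hv, (hNmem u hu).2.symm⟩⟩)
    (fun u hu => hmax u (hNmem u hu).1)
  have hfac : ∀ u ∈ R, cliqueRoot lam (d u) ≤ cliqueRoot lam #(nbrsOn G R u) := fun u _ =>
    (strictAnti_cliqueRoot hlam).antitone (Finset.card_le_card (nbrsOn_farOn_subset S u v))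
  have hRle : ∏ u ∈ R, cliqueRoot lam (d u) ≤ ∏ u ∈ R, cliqueRoot lam #(nbrsOn G R u) :=
    Finset.prod_le_prod (fun u _ => (cliqueRoot_pos hlam _).le) hfac
  have hp : 0 < ∏ u ∈ R, cliqueRoot lam (d u) :=
    Finset.prod_pos fun u _ => cliqueRoot_pos hlam _
  rw [hprodE] at ihE ihE_eq
  rw [hprodS, indepPolyOn_eq_add lam hv]
  have hloc' := mul_le_mul_of_nonneg_right hloc hp.le
  have hR1 := mul_le_mul_of_nonneg_left ihR hlam.le
  have hR2 := mul_le_mul_of_nonneg_left hRle hlam.le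
  rw [add_mul] at hloc'
  refine ⟨by linarith, fun heq => ?_, fun h => ?_⟩
  · have e1 : indepPolyOn G lam R = ∏ u ∈ R, cliqueRoot lam #(nbrsOn G R u) :=
      mul_left_cancel₀ hlam.ne' (by linarith)
    have e2 : ∏ u ∈ R, cliqueRoot lam (d u) = ∏ u ∈ R, cliqueRoot lam #(nbrsOn G R u) :=
      mul_left_cancel₀ hlam.ne' (by linarith)
    have e3 := hloc_eq (mul_right_cancel₀ hp.ne' (by rw [add_mul]; linarith))
    refine isCliqueUnionOn_of_farOn (ihR_eq.1 e1) (fun u hu => ?_) e3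
    refine Finset.eq_of_subset_of_card_le (nbrsOn_farOn_subset S u v) ?_
    by_contra! hlt
    exact e2.not_lt (Finset.prod_lt_prod (fun u _ => cliqueRoot_pos hlam _) hfac
      ⟨u, hu, strictAnti_cliqueRoot hlam hlt⟩)
  · rw [ihE_eq.2 (h.mono (Finset.erase_subset _ _)), ihR_eq.2 (h.mono hRS.1),
      cliqueRoot_mul_prod_of_eq hlam fun u hu => h.card_nbrsOn_eq hv hu, add_mul]
    congr 2
    exact Finset.prod_congr rfl fun u hu => by rw [h.nbrsOn_farOn_eq hv hu]

lemma isCliqueUnionOn_univ_iff [Fintype V] :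
    IsCliqueUnionOn G Finset.univ ↔ IsDisjUnionOfCliques G := by
  constructor
  · rintro h u v ⟨p⟩ huv
    induction p with
    | nil => exact absurd rfl huv
    | @cons a b c hab _ ih =>
      by_cases hbc : b = c
      · exact hbc ▸ hab
      · exact h a (Finset.mem_univ _) b (Finset.mem_univ _) c (Finset.mem_univ _) hab (ih hbc) huv
  · intro h u _ v _ w _ huv hvw huw
    exact h u w (huv.reachable.trans hvw.reachable) huw

end Induction

/-- **Sah–Sawhney–Stoner–Zhao (weighted lower bound).** For every graph `G` and `λ > 0`,
`P_G(λ) ≥ ∏_{v ∈ V(G)} ((d_v + 1)λ + 1)^{1/(d_v + 1)}`, with equality iff `G` is a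
disjoint union of cliques. -/
theorem indepPoly_lower_bound {V : Type*} [Fintype V] (G : SimpleGraph V)
    (lam : ℝ) (hlam : 0 < lam) :
    indepPoly G lam ≥
        ∏ v : V, (((G.degree v : ℝ) + 1) * lam + 1) ^ ((1:ℝ) / ((G.degree v : ℝ) + 1)) ∧
      (indepPoly G lam =
          ∏ v : V, (((G.degree v : ℝ) + 1) * lam + 1) ^ ((1:ℝ) / ((G.degree v : ℝ) + 1)) ↔
        IsDisjUnionOfCliques G) := by
  have hdeg : ∀ v, #(nbrsOn G Finset.univ v) = G.degree v := fun v => by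
    rw [← G.card_neighborFinset_eq_degree]
    congr 1
    ext u
    simp [mem_nbrsOn]
  have hpoly : indepPolyOn G lam Finset.univ = indepPoly G lam := by
    rw [indepPolyOn, indepPoly]
    refine Finset.sum_congr ?_ fun _ _ => rfl
    ext T
    simp
  have h := indepPolyOn_lower_bound (G := G) hlam Finset.univ
  simpa only [hdeg, hpoly, isCliqueUnionOn_univ_iff, cliqueRoot] using h
end

section
/- (Shearer's lemma.) Let X = (X₁, …, Xₙ) be a random vector whose coordinates take values in finite sets, let 𝒜 be a finite family (with repetition allowed) of subsets of {1, …, n}, and let m ≥ 1 be such that each index i ∈ {1, …, n} is contained in at least m members of 𝒜. Then the Shannon entropy satisfies H(X) ≤ (1/m) Σ_{A ∈ 𝒜} H(X_A), where X_A = (X_i : i ∈ A) denotes the restriction of X to the coordinates indexed by A. -/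
open Finset
open scoped Classical

/-- The Shannon entropy `H(p) = ∑_x p(x) log (1/p(x))` of a probability mass
function `p` on a finite type. -/
noncomputable def entropy {Ω : Type*} [Fintype Ω] (p : Ω → ℝ) : ℝ :=
  ∑ x : Ω, Real.negMulLog (p x)

/-- The marginal of a probability mass function `p` on `∏ i, α i` with respect to a
subset `A` of the coordinates: `p_A(y) = ∑_{x : x|_A = y} p(x)`. -/
noncomputable def marginal {n : ℕ} {α : Fin n → Type*} [∀ i, Fintype (α i)]
    (p : (∀ i, α i) → ℝ) (A : Finset (Fin n)) : ((i : A) → α i.val) → ℝ :=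
  fun y => ∑ x ∈ Finset.univ.filter (fun x : ∀ i, α i => ∀ i : A, x i.val = y i), p x

section Marginal

variable {n : ℕ} {α : Fin n → Type*} [∀ i, Fintype (α i)] {p : (∀ i, α i) → ℝ}

/-- The probability that a random vector agrees with `x` on the coordinates in `A`. -/
noncomputable def cylinderMass (p : (∀ i, α i) → ℝ) (A : Finset (Fin n)) (x : ∀ i, α i) : ℝ :=
  marginal p A fun i => x i

lemma cylinderMass_eq_sum (p : (∀ i, α i) → ℝ) (A : Finset (Fin n)) (x : ∀ i, α i) :
    cylinderMass p A x = ∑ y, if ∀ i ∈ A, y i = x i then p y else 0 := by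
  simp [cylinderMass, marginal, Finset.sum_filter]

lemma cylinderMass_congr {A : Finset (Fin n)} {x y : ∀ i, α i} (h : ∀ i ∈ A, x i = y i) :
    cylinderMass p A x = cylinderMass p A y :=
  congrArg (marginal p A) (funext fun i => h i i.2)

lemma cylinderMass_nonneg (hp : ∀ x, 0 ≤ p x) (A : Finset (Fin n)) (x : ∀ i, α i) :
    0 ≤ cylinderMass p A x :=
  Finset.sum_nonneg fun y _ => hp y

lemma cylinderMass_anti (hp : ∀ x, 0 ≤ p x) {A B : Finset (Fin n)} (h : A ⊆ B)
    (x : ∀ i, α i) : cylinderMass p B x ≤ cylinderMass p A x := by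
  simp only [cylinderMass_eq_sum]
  refine Finset.sum_le_sum fun y _ => ?_
  by_cases hB : ∀ i ∈ B, y i = x i
  · rw [if_pos hB, if_pos fun i hi => hB i (h hi)]
  · rw [if_neg hB]
    split_ifs
    exacts [hp y, le_rfl]

lemma cylinderMass_univ (p : (∀ i, α i) → ℝ) (x : ∀ i, α i) :
    cylinderMass p Finset.univ x = p x := by
  simp [cylinderMass_eq_sum, ← funext_iff]

lemma cylinderMass_empty (p : (∀ i, α i) → ℝ) (x : ∀ i, α i) :
    cylinderMass p ∅ x = ∑ y, p y := by
  simp [cylinderMass_eq_sum]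

lemma cylinderMass_pos (hp : ∀ x, 0 ≤ p x) (A : Finset (Fin n)) {x : ∀ i, α i}
    (hx : 0 < p x) : 0 < cylinderMass p A x :=
  hx.trans_le ((cylinderMass_univ p x).symm.le.trans
    (cylinderMass_anti hp (Finset.subset_univ A) x))

lemma entropy_marginal (p : (∀ i, α i) → ℝ) (A : Finset (Fin n)) :
    entropy (marginal p A) = ∑ x, p x * -Real.log (cylinderMass p A x) := by
  rw [entropy, ← Finset.sum_fiberwise Finset.univ (fun x : ∀ i, α i => fun i : A => x i.val)]
  refine Finset.sum_congr rfl fun y _ => ?_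
  have hy : marginal p A y
      = ∑ x with (fun i : A => x i.val) = y, p x := by
    simp only [marginal, funext_iff]
  rw [Real.negMulLog, neg_mul_comm]
  nth_rw 1 [hy]
  rw [Finset.sum_mul]
  refine Finset.sum_congr rfl fun x hx => ?_
  rw [cylinderMass, (Finset.mem_filter.1 hx).2]

lemma entropy_marginal_univ (p : (∀ i, α i) → ℝ) :
    entropy (marginal p Finset.univ) = entropy p := by
  rw [entropy_marginal, entropy]
  refine Finset.sum_congr rfl fun x _ => ?_
  rw [cylinderMass_univ, Real.negMulLog, neg_mul_comm]

lemma entropy_marginal_empty (hp1 : ∑ x, p x = 1) : entropy (marginal p ∅) = 0 := by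
  simp [entropy_marginal, cylinderMass_empty, hp1]

lemma entropy_marginal_mono (hp : ∀ x, 0 ≤ p x) {A B : Finset (Fin n)} (h : A ⊆ B) :
    entropy (marginal p A) ≤ entropy (marginal p B) := by
  rw [entropy_marginal, entropy_marginal]
  refine Finset.sum_le_sum fun x _ => ?_
  rcases (hp x).eq_or_lt with hx | hx
  · simp [← hx]
  · exact mul_le_mul_of_nonneg_left (neg_le_neg
      (Real.log_le_log (cylinderMass_pos hp B hx) (cylinderMass_anti hp h x))) hx.le

lemma sum_div_cylinderMass_le (hp : ∀ x, 0 ≤ p x) (A B : Finset (Fin n)) (y z : ∀ i, α i) :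
    (∑ x, if (∀ i ∈ A, y i = x i) ∧ ∀ i ∈ B, z i = x i then
        p x / (cylinderMass p (A ∪ B) x * cylinderMass p (A ∩ B) x) else 0)
      ≤ if ∀ i ∈ A ∩ B, z i = y i then (cylinderMass p (A ∩ B) y)⁻¹ else 0 := by
  by_cases hw : ∃ w : ∀ i, α i, (∀ i ∈ A, y i = w i) ∧ ∀ i ∈ B, z i = w i
  · obtain ⟨w, hyw, hzw⟩ := hw
    have hzy : ∀ i ∈ A ∩ B, z i = y i := fun i hi =>
      (hzw i (Finset.mem_inter.1 hi).2).trans (hyw i (Finset.mem_inter.1 hi).1).symm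
    rw [if_pos hzy]
    have key : ∀ x : ∀ i, α i,
        (if (∀ i ∈ A, y i = x i) ∧ ∀ i ∈ B, z i = x i then
          p x / (cylinderMass p (A ∪ B) x * cylinderMass p (A ∩ B) x) else 0)
        = (if ∀ i ∈ A ∪ B, x i = w i then p x else 0)
          * ((cylinderMass p (A ∪ B) w)⁻¹ * (cylinderMass p (A ∩ B) y)⁻¹) := by
      intro x
      have hiff : ((∀ i ∈ A, y i = x i) ∧ ∀ i ∈ B, z i = x i) ↔ ∀ i ∈ A ∪ B, x i = w i := by
        grind
      by_cases hx : ∀ i ∈ A ∪ B, x i = w i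
      · have hxy : ∀ i ∈ A ∩ B, x i = y i := by grind
        rw [if_pos (hiff.2 hx), if_pos hx, cylinderMass_congr hx, cylinderMass_congr hxy,
          div_eq_mul_inv, mul_inv]
      · rw [if_neg (hiff.not.2 hx), if_neg hx, zero_mul]
    rw [Finset.sum_congr rfl fun x _ => key x, ← Finset.sum_mul, ← cylinderMass_eq_sum,
      ← mul_assoc]
    exact mul_le_of_le_one_left (inv_nonneg.2 (cylinderMass_nonneg hp _ _)) mul_inv_le_one
  · rw [Finset.sum_eq_zero fun x _ => if_neg fun hx => hw ⟨x, hx⟩]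
    split_ifs
    exacts [inv_nonneg.2 (cylinderMass_nonneg hp _ _), le_rfl]

lemma sum_mul_cylinderMass_ratio_le (hp : ∀ x, 0 ≤ p x) (A B : Finset (Fin n)) :
    ∑ x, p x * (cylinderMass p A x * cylinderMass p B x
        / (cylinderMass p (A ∪ B) x * cylinderMass p (A ∩ B) x)) ≤ ∑ x, p x := by
  calc
    _ = ∑ x, ∑ y, ∑ z, p y * p z * (if (∀ i ∈ A, y i = x i) ∧ ∀ i ∈ B, z i = x i then
          p x / (cylinderMass p (A ∪ B) x * cylinderMass p (A ∩ B) x) else 0) := by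
      refine Finset.sum_congr rfl fun x _ => ?_
      rw [← mul_div_assoc, mul_div_right_comm, cylinderMass_eq_sum p A,
        cylinderMass_eq_sum p B, Finset.sum_mul_sum, Finset.mul_sum]
      refine Finset.sum_congr rfl fun y _ => ?_
      rw [Finset.mul_sum]
      refine Finset.sum_congr rfl fun z _ => ?_
      rw [ite_and]
      split_ifs <;> ring
    _ = ∑ y, ∑ z, p y * p z * ∑ x, (if (∀ i ∈ A, y i = x i) ∧ ∀ i ∈ B, z i = x i then
          p x / (cylinderMass p (A ∪ B) x * cylinderMass p (A ∩ B) x) else 0) := by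
      simp only [Finset.mul_sum]
      rw [Finset.sum_comm]
      exact Finset.sum_congr rfl fun y _ => Finset.sum_comm
    _ ≤ ∑ y, ∑ z, p y * p z *
          (if ∀ i ∈ A ∩ B, z i = y i then (cylinderMass p (A ∩ B) y)⁻¹ else 0) :=
      Finset.sum_le_sum fun y _ => Finset.sum_le_sum fun z _ =>
        mul_le_mul_of_nonneg_left (sum_div_cylinderMass_le hp A B y z)
          (mul_nonneg (hp y) (hp z))
    _ = ∑ y, p y * (cylinderMass p (A ∩ B) y * (cylinderMass p (A ∩ B) y)⁻¹) := by
      refine Finset.sum_congr rfl fun y _ => ?_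
      nth_rw 2 [cylinderMass_eq_sum]
      rw [Finset.sum_mul, Finset.mul_sum]
      refine Finset.sum_congr rfl fun z _ => ?_
      by_cases hz : ∀ i ∈ A ∩ B, z i = y i
      · rw [if_pos hz, if_pos hz, mul_assoc]
      · rw [if_neg hz, if_neg hz, mul_zero, zero_mul, mul_zero]
    _ ≤ ∑ y, p y :=
      Finset.sum_le_sum fun y _ => mul_le_of_le_one_right (hp y) mul_inv_le_one

/-- Submodularity of entropy. -/
lemma entropy_marginal_union_add_inter_le (hp : ∀ x, 0 ≤ p x) (A B : Finset (Fin n)) :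
    entropy (marginal p (A ∪ B)) + entropy (marginal p (A ∩ B))
      ≤ entropy (marginal p A) + entropy (marginal p B) := by
  have hlog : ∀ x, p x * -Real.log (cylinderMass p (A ∪ B) x)
      + p x * -Real.log (cylinderMass p (A ∩ B) x)
      ≤ p x * -Real.log (cylinderMass p A x) + p x * -Real.log (cylinderMass p B x)
        + (p x * (cylinderMass p A x * cylinderMass p B x
          / (cylinderMass p (A ∪ B) x * cylinderMass p (A ∩ B) x)) - p x) := by
    intro x
    rcases (hp x).eq_or_lt with hx | hx
    · simp [← hx]
    have hA := cylinderMass_pos hp A hx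
    have hB := cylinderMass_pos hp B hx
    have hU := cylinderMass_pos hp (A ∪ B) hx
    have hI := cylinderMass_pos hp (A ∩ B) hx
    have h := mul_le_mul_of_nonneg_left
      (Real.log_le_sub_one_of_pos (div_pos (mul_pos hA hB) (mul_pos hU hI))) hx.le
    rw [Real.log_div (mul_pos hA hB).ne' (mul_pos hU hI).ne', Real.log_mul hA.ne' hB.ne',
      Real.log_mul hU.ne' hI.ne'] at h
    linarith
  have hsum := Finset.sum_le_sum fun x (_ : x ∈ Finset.univ) => hlog x
  simp only [Finset.sum_add_distrib, Finset.sum_sub_distrib] at hsum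
  simp only [entropy_marginal]
  linarith [sum_mul_cylinderMass_ratio_le hp A B]

lemma mul_entropy_marginal_le (hp : ∀ x, 0 ≤ p x) (hp1 : ∑ x, p x = 1) {k m : ℕ}
    (A : Fin k → Finset (Fin n))
    (hcover : ∀ i : Fin n, m ≤ (Finset.univ.filter fun j => i ∈ A j).card)
    (P : Finset (Fin n)) :
    (m : ℝ) * entropy (marginal p P) ≤ ∑ j, entropy (marginal p (A j ∩ P)) := by
  induction P using Finset.induction_on with
  | empty =>
    rw [entropy_marginal_empty hp1, mul_zero]
    exact Finset.sum_nonneg fun j _ => by rw [Finset.inter_empty, entropy_marginal_empty hp1]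
  | insert i P hi ih =>
    set d := entropy (marginal p (insert i P)) - entropy (marginal p P) with hd
    have hd0 : 0 ≤ d := sub_nonneg.2 (entropy_marginal_mono hp (Finset.subset_insert i P))
    have hstep : ∀ j, entropy (marginal p (A j ∩ P)) + (if i ∈ A j then d else 0)
        ≤ entropy (marginal p (A j ∩ insert i P)) := by
      intro j
      by_cases hj : i ∈ A j
      · have h := entropy_marginal_union_add_inter_le hp P (A j ∩ insert i P)
        rw [show P ∪ A j ∩ insert i P = insert i P by grind,
          show P ∩ (A j ∩ insert i P) = A j ∩ P by grind] at h
        rw [if_pos hj]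
        linarith
      · rw [if_neg hj, add_zero, Finset.inter_insert_of_notMem hj]
    have hsum := Finset.sum_le_sum fun j (_ : j ∈ Finset.univ) => hstep j
    rw [Finset.sum_add_distrib, ← Finset.sum_filter, Finset.sum_const, nsmul_eq_mul] at hsum
    have hm := mul_le_mul_of_nonneg_right (Nat.cast_le (α := ℝ).2 (hcover i)) hd0
    have hmd : (m : ℝ) * d
        = m * entropy (marginal p (insert i P)) - m * entropy (marginal p P) := mul_sub _ _ _
    linarith

end Marginal

/-- **Shearer's lemma.** Let `X = (X₁, …, Xₙ)` be a random vector with finitely many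
values, given by its joint probability mass function `p`, and let `A 0, …, A (k-1)` be a
family of subsets of coordinates such that every coordinate lies in at least `m ≥ 1` of
them. Then `H(X) ≤ (1/m) ∑ j, H(X_{A j})`. -/
theorem shearer {n : ℕ} {α : Fin n → Type*} [∀ i, Fintype (α i)]
    (p : (∀ i, α i) → ℝ) (hp0 : ∀ x, 0 ≤ p x) (hp1 : ∑ x, p x = 1)
    (k : ℕ) (A : Fin k → Finset (Fin n)) (m : ℕ) (hm : 1 ≤ m)
    (hcover : ∀ i : Fin n, m ≤ (Finset.univ.filter fun j => i ∈ A j).card) :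
    entropy p ≤ (1 / (m : ℝ)) * ∑ j : Fin k, entropy (marginal p (A j)) := by
  have h := mul_entropy_marginal_le hp0 hp1 A hcover Finset.univ
  rw [entropy_marginal_univ, Finset.sum_congr rfl fun j _ =>
    show entropy (marginal p (A j ∩ Finset.univ)) = entropy (marginal p (A j)) by
      rw [Finset.inter_univ]] at h
  have hm0 : (0 : ℝ) < m := Nat.cast_pos.2 hm
  rwa [one_div, ← div_eq_inv_mul, le_div_iff₀' hm0]
end
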